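/- arXiv:2510.03373 — 2 statements merged into one kernel-verified Lean document; each statement's English description precedes it below -/
import Mathlib

section
/- Let P be a Perron system and 𝔓⁻ the associated family of unions of consecutive P⁻-cylinders. Then for every set E ⊆ (0,1) \ IS^{P⁻} and every α > 0 one has H^α(E) ≤ H^α(E, 𝔓⁻) ≤ 3·H^α(E), where H^α denotes the usual α-dimensional Hausdorff measure; consequently 𝔓⁻ is a faithful family of coverings for the Hausdorff dimension calculation on (0,1) \ IS^{P⁻}, i.e. dim_H(E, 𝔓⁻) = dim_H(E) for every E ⊆ (0,1) \ IS^{P⁻}. -/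
open Set Filter MeasureTheory
open scoped ENNReal

noncomputable section

/-- A Perron system `P = (φ_n)`: `φ₀ = φ []` and `φ_n(c₁,…,c_n) = φ [c₁,…,c_n]`;
all values are positive integers. -/
structure PerronSystem where
  φ : List ℕ → ℕ
  φ_pos : ∀ l, 0 < φ l

/-- `(c₁−1)c₁⋯(c_n−1)c_n` (0-based indexing: `c 0 = c₁`). -/
def qprod (c : ℕ → ℕ) (n : ℕ) : ℝ :=
  ∏ i ∈ Finset.range n, (((c i : ℝ) - 1) * (c i : ℝ))

namespace PerronSystem

variable (P : PerronSystem)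

/-- `r P c 0 = φ₀` and `r P c n = φ_n(c₁,…,c_n)`. -/
def r (c : ℕ → ℕ) (n : ℕ) : ℕ := P.φ (List.ofFn fun j : Fin n => c j)

/-- The word `c₁ … c_k` is P-admissible: `c_i ≥ φ_{i−1}(c₁,…,c_{i−1}) + 1`. -/
def AdmissibleUpTo (c : ℕ → ℕ) (k : ℕ) : Prop := ∀ i < k, P.r c i + 1 ≤ c i

/-- The infinite digit sequence `c` is P-admissible. -/
def Admissible (c : ℕ → ℕ) : Prop := ∀ i, P.r c i + 1 ≤ c i

/-- `r₀ r₁ ⋯ r_{n−1}`. -/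
def rprod (c : ℕ → ℕ) (n : ℕ) : ℝ := ∏ i ∈ Finset.range n, (P.r c i : ℝ)

/-- Diameter `D_k = r₀⋯r_{k−1} / ((c₁−1)c₁⋯(c_k−1)c_k)` of the cylinder with base `c₁…c_k`. -/
def D (c : ℕ → ℕ) (k : ℕ) : ℝ := P.rprod c k / qprod c k

/-- `S_k`, the infimum of the positive Perron cylinder with base `c₁…c_k`. -/
def S (c : ℕ → ℕ) (k : ℕ) : ℝ :=
  ∑ n ∈ Finset.range k, P.rprod c (n + 1) / (qprod c n * (c n : ℝ))

/-- The positive Perron cylinder `Δ^P_{c₁…c_k} = (S_k, S_k + D_k]`. -/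
def cyl (c : ℕ → ℕ) (k : ℕ) : Set ℝ := Ioc (P.S c k) (P.S c k + P.D c k)

/-- `A_k = ∑_{n=0}^{k−1} (−1)^n r₀⋯r_n / ((c₁−1)c₁⋯(c_n−1)c_n (c_{n+1}−1))`. -/
def A (c : ℕ → ℕ) (k : ℕ) : ℝ :=
  ∑ n ∈ Finset.range k, (-1 : ℝ) ^ n * P.rprod c (n + 1) / (qprod c n * ((c n : ℝ) - 1))

/-- The second endpoint `A_k + (−1)^k D_k` of the interval `I_{c₁…c_k}`. -/
def altEnd (c : ℕ → ℕ) (k : ℕ) : ℝ := P.A c k + (-1 : ℝ) ^ k * P.D c k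

/-- The countable set `IS^{P⁻}` of endpoints of the intervals `I_{c₁…c_k}`
(the word of length `0` contributes the endpoints `0` and `1`). -/
def IS : Set ℝ :=
  {x | ∃ (c : ℕ → ℕ) (k : ℕ), P.AdmissibleUpTo c k ∧ (x = P.A c k ∨ x = P.altEnd c k)}

/-- The alternating Perron cylinder `Δ^{P⁻}_{c₁…c_k} = I_{c₁…c_k} \ IS^{P⁻}`. -/
def altCyl (c : ℕ → ℕ) (k : ℕ) : Set ℝ :=
  Ioo (min (P.A c k) (P.altEnd c k)) (max (P.A c k) (P.altEnd c k)) \ P.IS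

/-- The family `𝔓` of all unions of consecutive positive Perron cylinders of the same
rank contained in a single cylinder of the previous rank. -/
def famP : Set (Set ℝ) :=
  {U | ∃ (c : ℕ → ℕ) (k n : ℕ), P.AdmissibleUpTo c k ∧ P.r c k + 1 ≤ n ∧
      ((∃ m, n ≤ m ∧ U = ⋃ i ∈ Finset.Icc n m, P.cyl (Function.update c k i) (k + 1)) ∨
        U = ⋃ i ∈ {j : ℕ | n ≤ j}, P.cyl (Function.update c k i) (k + 1))}

/-- The subfamily `𝔓₁ ⊆ 𝔓` of finite unions. -/
def famP1 : Set (Set ℝ) :=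
  {U | ∃ (c : ℕ → ℕ) (k n m : ℕ), P.AdmissibleUpTo c k ∧ P.r c k + 1 ≤ n ∧ n ≤ m ∧
      U = ⋃ i ∈ Finset.Icc n m, P.cyl (Function.update c k i) (k + 1)}

/-- The family `𝔓⁻` of all unions of consecutive alternating Perron cylinders of the same
rank contained in a single cylinder of the previous rank. -/
def famAlt : Set (Set ℝ) :=
  {U | ∃ (c : ℕ → ℕ) (k n : ℕ), P.AdmissibleUpTo c k ∧ P.r c k + 1 ≤ n ∧
      ((∃ m, n ≤ m ∧ U = ⋃ i ∈ Finset.Icc n m, P.altCyl (Function.update c k i) (k + 1)) ∨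
        U = ⋃ i ∈ {j : ℕ | n ≤ j}, P.altCyl (Function.update c k i) (k + 1))}

/-- The subfamily `𝔓₁⁻ ⊆ 𝔓⁻` of finite unions. -/
def famAlt1 : Set (Set ℝ) :=
  {U | ∃ (c : ℕ → ℕ) (k n m : ℕ), P.AdmissibleUpTo c k ∧ P.r c k + 1 ≤ n ∧ n ≤ m ∧
      U = ⋃ i ∈ Finset.Icc n m, P.altCyl (Function.update c k i) (k + 1)}

/-- The value `Δ^P_c` of the positive Perron expansion with digit sequence `c`. -/
def posValue (c : ℕ → ℕ) : ℝ :=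
  ∑' n : ℕ, P.rprod c (n + 1) / (qprod c n * (c n : ℝ))

/-- The value `Δ^{P⁻}_c` of the alternating Perron expansion with digit sequence `c`. -/
def altValue (c : ℕ → ℕ) : ℝ :=
  ∑' n : ℕ, (-1 : ℝ) ^ n * P.rprod c (n + 1) / (qprod c n * ((c n : ℝ) - 1))

end PerronSystem

/-- The Hausdorff `α`-dimensional measure of `E` with respect to a family of coverings `Φ`. -/
def Hfam (Φ : Set (Set ℝ)) (α : ℝ) (E : Set ℝ) : ℝ≥0∞ :=
  ⨆ (ε : ℝ) (_ : 0 < ε),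
    ⨅ (f : ℕ → Set ℝ) (_ : E ⊆ ⋃ n, f n) (_ : ∀ n, f n ∈ Φ)
      (_ : ∀ n, EMetric.diam (f n) ≤ ENNReal.ofReal ε),
      ∑' n : ℕ, EMetric.diam (f n) ^ α

/-- The Hausdorff dimension of `E` with respect to a family of coverings `Φ`:
`inf {α > 0 : H^α(E, Φ) = 0}` (equal to `∞` if no such `α` exists). -/
def dimFam (Φ : Set (Set ℝ)) (E : Set ℝ) : ℝ≥0∞ :=
  ⨅ (α : ℝ) (_ : 0 < α) (_ : Hfam Φ α E = 0), ENNReal.ofReal α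

end

namespace PerronSystem

variable (P : PerronSystem)

/-- signed position inside a cylinder -/
noncomputable def pos (c : ℕ → ℕ) (k : ℕ) (x : ℝ) : ℝ := (-1 : ℝ) ^ k * (x - P.A c k)

/-- `L = D_k r_k` -/
noncomputable def Lr (c : ℕ → ℕ) (k : ℕ) : ℝ := P.D c k * (P.r c k : ℝ)

lemma r_pos (c : ℕ → ℕ) (k : ℕ) : 0 < P.r c k := P.φ_pos _

lemma r_congr {c d : ℕ → ℕ} {k : ℕ} (h : ∀ i < k, c i = d i) : P.r c k = P.r d k := by
  unfold r
  congr 1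
  congr 1
  funext j
  exact h j j.2

lemma rprod_congr {c d : ℕ → ℕ} {k : ℕ} (h : ∀ i < k, c i = d i) {n : ℕ} (hn : n ≤ k + 1) :
    P.rprod c n = P.rprod d n := by
  unfold rprod
  refine Finset.prod_congr rfl fun i hi => ?_
  rw [Finset.mem_range] at hi
  rw [P.r_congr (fun j hj => h j (by omega))]

lemma qprod_congr {c d : ℕ → ℕ} {k : ℕ} (h : ∀ i < k, c i = d i) {n : ℕ} (hn : n ≤ k) :
    qprod c n = qprod d n := by
  unfold qprod
  refine Finset.prod_congr rfl fun i hi => ?_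
  rw [Finset.mem_range] at hi
  rw [h i (by omega)]

lemma A_congr {c d : ℕ → ℕ} {k : ℕ} (h : ∀ i < k, c i = d i) : P.A c k = P.A d k := by
  unfold A
  refine Finset.sum_congr rfl fun i hi => ?_
  rw [Finset.mem_range] at hi
  rw [P.rprod_congr h (by omega), qprod_congr h (by omega), h i hi]

lemma upd_eq (c : ℕ → ℕ) (k i : ℕ) : ∀ j < k, Function.update c k i j = c j := by
  intro j hj
  rw [Function.update_of_ne (by omega)]

lemma adm_upd {c : ℕ → ℕ} {k i : ℕ} (h : P.AdmissibleUpTo c k) (hi : P.r c k + 1 ≤ i) :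
    P.AdmissibleUpTo (Function.update c k i) (k + 1) := by
  intro j hj
  rcases Nat.lt_succ_iff_lt_or_eq.1 hj with hj | rfl
  · rw [upd_eq c k i j hj, P.r_congr (fun a ha => upd_eq c k i a (by omega))]
    exact h j hj
  · rw [Function.update_self, P.r_congr (upd_eq c j i)]
    exact hi

lemma D_pos {c : ℕ → ℕ} {k : ℕ} (h : P.AdmissibleUpTo c k) : 0 < P.D c k := by
  unfold D rprod qprod
  apply div_pos
  · exact Finset.prod_pos fun i _ => by exact_mod_cast P.r_pos c i
  · refine Finset.prod_pos fun i hi => ?_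
    have h1 := h i (Finset.mem_range.1 hi)
    have h2 := P.r_pos c i
    have : (2 : ℝ) ≤ c i := by exact_mod_cast (by omega : 2 ≤ c i)
    apply mul_pos <;> linarith

lemma Lr_pos {c : ℕ → ℕ} {k : ℕ} (h : P.AdmissibleUpTo c k) : 0 < P.Lr c k :=
  mul_pos (P.D_pos h) (by exact_mod_cast P.r_pos c k)

lemma D_upd (c : ℕ → ℕ) (k i : ℕ) :
    P.D (Function.update c k i) (k + 1) = P.Lr c k / (((i : ℝ) - 1) * i) := by
  unfold Lr D
  rw [P.rprod_congr (upd_eq c k i) le_rfl]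
  have : qprod (Function.update c k i) (k + 1) = qprod c k * (((i : ℝ) - 1) * i) := by
    have h := qprod_congr (upd_eq c k i) le_rfl
    unfold qprod at h ⊢
    rw [Finset.prod_range_succ, h]
    simp
  rw [this]
  unfold rprod
  rw [Finset.prod_range_succ]
  rw [div_mul_eq_mul_div, div_div]

lemma A_upd (c : ℕ → ℕ) (k i : ℕ) :
    P.A (Function.update c k i) (k + 1) = P.A c k + (-1) ^ k * (P.Lr c k / ((i : ℝ) - 1)) := by
  have h := P.A_congr (upd_eq c k i)
  have h1 := P.rprod_congr (upd_eq c k i) le_rfl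
  have h2 := qprod_congr (upd_eq c k i) le_rfl
  unfold A at h ⊢
  rw [Finset.sum_range_succ, h, h1, h2]
  simp only [Function.update_self]
  congr 1
  unfold Lr D rprod
  rw [Finset.prod_range_succ]
  rw [div_mul_eq_mul_div, div_div, mul_div_assoc]

lemma neg_one_sq (k : ℕ) : ((-1 : ℝ) ^ k) * (-1) ^ k = 1 := by
  rw [← mul_pow]; simp

lemma pos_upd (c : ℕ → ℕ) (k i : ℕ) (x : ℝ) :
    P.pos (Function.update c k i) (k + 1) x = P.Lr c k / ((i : ℝ) - 1) - P.pos c k x := by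
  unfold pos
  rw [A_upd, pow_succ]
  linear_combination (P.Lr c k / ((i : ℝ) - 1)) * neg_one_sq k

lemma abs_pos_sub (c : ℕ → ℕ) (k : ℕ) (x y : ℝ) :
    |P.pos c k x - P.pos c k y| = |x - y| := by
  unfold pos
  rw [← mul_sub, abs_mul]
  simp

lemma mem_altCyl {c : ℕ → ℕ} {k : ℕ} (h : P.AdmissibleUpTo c k) (x : ℝ) :
    x ∈ P.altCyl c k ↔ (0 < P.pos c k x ∧ P.pos c k x < P.D c k) ∧ x ∉ P.IS := by
  have hD := P.D_pos h
  unfold altCyl pos altEnd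
  rw [mem_diff, mem_Ioo]
  apply and_congr_left
  intro _
  rcases neg_one_pow_eq_or ℝ k with h1 | h1 <;> rw [h1]
  · rw [min_eq_left (by linarith), max_eq_right (by linarith)]
    constructor <;> rintro ⟨a, b⟩ <;> constructor <;> linarith
  · rw [min_eq_right (by linarith), max_eq_left (by linarith)]
    constructor <;> rintro ⟨a, b⟩ <;> constructor <;> linarith

lemma two_le_of_adm {c : ℕ → ℕ} {k i : ℕ} (hi : P.r c k + 1 ≤ i) : 2 ≤ i := by
  have := P.r_pos c k
  omega

lemma D_upd' (c : ℕ → ℕ) (k : ℕ) {i : ℕ} (hi : 2 ≤ i) :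
    P.D (Function.update c k i) (k + 1) = P.Lr c k / ((i : ℝ) - 1) - P.Lr c k / i := by
  rw [D_upd]
  have : (2 : ℝ) ≤ i := by exact_mod_cast hi
  have h1 : (i : ℝ) - 1 ≠ 0 := by linarith
  have h2 : (i : ℝ) ≠ 0 := by linarith
  field_simp
  ring

lemma mem_child {c : ℕ → ℕ} {k i : ℕ} (h : P.AdmissibleUpTo c k) (hi : P.r c k + 1 ≤ i) (x : ℝ) :
    x ∈ P.altCyl (Function.update c k i) (k + 1) ↔
      (P.Lr c k / i < P.pos c k x ∧ P.pos c k x < P.Lr c k / ((i : ℝ) - 1)) ∧ x ∉ P.IS := by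
  rw [P.mem_altCyl (P.adm_upd h hi), pos_upd, P.D_upd' c k (P.two_le_of_adm hi)]
  apply and_congr_left
  intro _
  constructor <;> rintro ⟨a, b⟩ <;> constructor <;> linarith

lemma exists_child {c : ℕ → ℕ} {k : ℕ} (h : P.AdmissibleUpTo c k) {x : ℝ}
    (hx : x ∈ P.altCyl c k) :
    ∃ i, P.r c k + 1 ≤ i ∧ x ∈ P.altCyl (Function.update c k i) (k + 1) := by
  rw [P.mem_altCyl h] at hx
  obtain ⟨⟨h0, h1⟩, hIS⟩ := hx
  have hL := P.Lr_pos h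
  have hD := P.D_pos h
  set u := P.pos c k x with hu
  have hq : 0 < P.Lr c k / u := div_pos hL h0
  set j := ⌊P.Lr c k / u⌋₊ with hj
  have hj1 : (j : ℝ) ≤ P.Lr c k / u := Nat.floor_le hq.le
  have hj2 : P.Lr c k / u < j + 1 := Nat.lt_floor_add_one _
  have hrj : P.r c k ≤ j := by
    apply Nat.le_floor
    rw [le_div_iff₀ h0]
    unfold Lr
    rw [mul_comm]
    have := P.r_pos c k
    gcongr
  have hadm : P.r c k + 1 ≤ j + 1 := by omega
  refine ⟨j + 1, hadm, ?_⟩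
  rw [P.mem_child h hadm]
  have hjp : (0 : ℝ) < j := by exact_mod_cast (P.r_pos c k).trans_le hrj
  rw [le_div_iff₀ h0] at hj1
  rw [div_lt_iff₀ h0] at hj2
  push_cast
  refine ⟨⟨?_, ?_⟩, hIS⟩
  · rw [div_lt_iff₀ (by linarith)]; linarith
  · have : u ≠ P.Lr c k / j := by
      intro he
      apply hIS
      refine ⟨Function.update c k (j + 1), k + 1, P.adm_upd h hadm, Or.inl ?_⟩
      rw [A_upd]
      push_cast
      rw [add_sub_cancel_right, ← he, hu]
      unfold pos
      linear_combination (P.A c k - x) * neg_one_sq k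
    rw [add_sub_cancel_right]
    refine lt_of_le_of_ne ?_ this
    rw [le_div_iff₀ hjp]; linarith

lemma ediam_le_pos (c : ℕ → ℕ) (k : ℕ) {V : Set ℝ} {a b : ℝ}
    (h : ∀ x ∈ V, a ≤ P.pos c k x ∧ P.pos c k x ≤ b) :
    Metric.ediam V ≤ ENNReal.ofReal (b - a) := by
  refine Metric.ediam_le fun x hx y hy => ?_
  rw [edist_dist, Real.dist_eq, ← P.abs_pos_sub c k]
  apply ENNReal.ofReal_le_ofReal
  have h1 := h x hx
  have h2 := h y hy
  rw [abs_le]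
  constructor <;> linarith

/-- infinite unions -/
def VI (c : ℕ → ℕ) (k n : ℕ) : Set ℝ :=
  ⋃ i ∈ {j : ℕ | n ≤ j}, P.altCyl (Function.update c k i) (k + 1)

/-- finite unions -/
def VF (c : ℕ → ℕ) (k n m : ℕ) : Set ℝ :=
  ⋃ i ∈ Finset.Icc n m, P.altCyl (Function.update c k i) (k + 1)

lemma VI_mem {c : ℕ → ℕ} {k n : ℕ} (h : P.AdmissibleUpTo c k) (hn : P.r c k + 1 ≤ n) :
    P.VI c k n ∈ P.famAlt := ⟨c, k, n, h, hn, Or.inr rfl⟩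

lemma VF_mem {c : ℕ → ℕ} {k n m : ℕ} (h : P.AdmissibleUpTo c k) (hn : P.r c k + 1 ≤ n)
    (hm : n ≤ m) : P.VF c k n m ∈ P.famAlt := ⟨c, k, n, h, hn, Or.inl ⟨m, hm, rfl⟩⟩

lemma VI_diam {c : ℕ → ℕ} {k n : ℕ} (h : P.AdmissibleUpTo c k) (hn : P.r c k + 1 ≤ n) :
    Metric.ediam (P.VI c k n) ≤ ENNReal.ofReal (P.Lr c k / ((n : ℝ) - 1)) := by
  have hL := P.Lr_pos h
  rw [← sub_zero (P.Lr c k / ((n : ℝ) - 1))]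
  apply P.ediam_le_pos c k
  intro x hx
  simp only [VI, mem_iUnion, mem_setOf_eq] at hx
  obtain ⟨i, hi, hx⟩ := hx
  rw [P.mem_child h (hn.trans hi)] at hx
  have h2 : (2 : ℝ) ≤ n := by exact_mod_cast P.two_le_of_adm hn
  have h3 : (n : ℝ) ≤ i := by exact_mod_cast hi
  constructor
  · refine le_trans ?_ hx.1.1.le
    positivity
  · refine hx.1.2.le.trans ?_
    have : (0 : ℝ) < n - 1 := by linarith
    gcongr

lemma VF_diam {c : ℕ → ℕ} {k n m : ℕ} (h : P.AdmissibleUpTo c k) (hn : P.r c k + 1 ≤ n) :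
    Metric.ediam (P.VF c k n m) ≤
      ENNReal.ofReal (P.Lr c k / ((n : ℝ) - 1) - P.Lr c k / m) := by
  have hL := P.Lr_pos h
  apply P.ediam_le_pos c k
  intro x hx
  simp only [VF, mem_iUnion, Finset.mem_Icc] at hx
  obtain ⟨i, hi, hx⟩ := hx
  rw [P.mem_child h (hn.trans hi.1)] at hx
  have h2 : (2 : ℝ) ≤ n := by exact_mod_cast P.two_le_of_adm hn
  have h3 : (n : ℝ) ≤ i := by exact_mod_cast hi.1
  have h4 : (i : ℝ) ≤ m := by exact_mod_cast hi.2
  constructor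
  · refine le_trans ?_ hx.1.1.le
    have : (0 : ℝ) < i := by linarith
    gcongr
  · refine hx.1.2.le.trans ?_
    have : (0 : ℝ) < n - 1 := by linarith
    gcongr

lemma subset_VI {c : ℕ → ℕ} {k n i : ℕ} (hi : n ≤ i) :
    P.altCyl (Function.update c k i) (k + 1) ⊆ P.VI c k n := by
  intro x hx
  simp only [VI, mem_iUnion, mem_setOf_eq]
  exact ⟨i, hi, hx⟩

lemma subset_VF {c : ℕ → ℕ} {k n m i : ℕ} (hi : n ≤ i) (hm : i ≤ m) :
    P.altCyl (Function.update c k i) (k + 1) ⊆ P.VF c k n m := by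
  intro x hx
  simp only [VF, mem_iUnion, Finset.mem_Icc]
  exact ⟨i, ⟨hi, hm⟩, hx⟩

lemma D_eq (c : ℕ → ℕ) (k : ℕ) : P.D c k = P.Lr c k / (P.r c k : ℝ) := by
  have : (P.r c k : ℝ) ≠ 0 := by exact_mod_cast (P.r_pos c k).ne'
  unfold Lr
  field_simp

lemma cover_a {c : ℕ → ℕ} {k : ℕ} (h : P.AdmissibleUpTo c k) {F : Set ℝ} (hne : F.Nonempty)
    (hF : F ⊆ P.altCyl c k) :
    ∃ V ∈ P.famAlt, F ⊆ V ∧ ∃ y ∈ F, Metric.ediam V ≤ ENNReal.ofReal (2 * P.pos c k y) := by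
  classical
  have hex : ∃ i, P.r c k + 1 ≤ i ∧ ∃ y ∈ F, y ∈ P.altCyl (Function.update c k i) (k + 1) := by
    obtain ⟨y, hy⟩ := hne
    obtain ⟨i, hi, hyi⟩ := P.exists_child h (hF hy)
    exact ⟨i, hi, y, hy, hyi⟩
  obtain ⟨hn, y, hy, hyn⟩ := Nat.find_spec hex
  have hmin : ∀ i, P.r c k + 1 ≤ i → (∃ y ∈ F, y ∈ P.altCyl (Function.update c k i) (k + 1)) →
    Nat.find hex ≤ i := fun i h1 h2 => Nat.find_min' hex ⟨h1, h2⟩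
  generalize Nat.find hex = n at *
  refine ⟨P.VI c k n, P.VI_mem h hn, ?_, y, hy, (P.VI_diam h hn).trans ?_⟩
  · intro x hx
    obtain ⟨i, hi, hxi⟩ := P.exists_child h (hF hx)
    exact P.subset_VI (hmin i hi ⟨x, hx, hxi⟩) hxi
  · apply ENNReal.ofReal_le_ofReal
    rw [P.mem_child h hn] at hyn
    have h2 : (2 : ℝ) ≤ n := by exact_mod_cast P.two_le_of_adm hn
    have hL := P.Lr_pos h
    have h3 : P.Lr c k / ((n : ℝ) - 1) ≤ 2 * (P.Lr c k / n) := by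
      rw [← mul_div_assoc, div_le_div_iff₀ (by linarith) (by linarith)]
      nlinarith
    linarith [hyn.1.1]

lemma cover_b {c : ℕ → ℕ} {k : ℕ} (h : P.AdmissibleUpTo c k) {F : Set ℝ} (hne : F.Nonempty)
    (hF : F ⊆ P.altCyl c k) :
    ∃ V ∈ P.famAlt, F ⊆ V ∧
      ∃ y ∈ F, Metric.ediam V ≤ ENNReal.ofReal (2 * (P.D c k - P.pos c k y)) := by
  classical
  have hL := P.Lr_pos h
  have hr : (1 : ℝ) ≤ P.r c k := by exact_mod_cast P.r_pos c k
  have hDL := P.D_eq c k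
  by_cases hbig : ∃ i, 2 * P.r c k + 1 ≤ i ∧
      ∃ y ∈ F, y ∈ P.altCyl (Function.update c k i) (k + 1)
  · obtain ⟨i, hi, y, hy, hyi⟩ := hbig
    refine ⟨P.VI c k (P.r c k + 1), P.VI_mem h le_rfl, ?_, y, hy, (P.VI_diam h le_rfl).trans ?_⟩
    · intro x hx
      obtain ⟨i, hi, hxi⟩ := P.exists_child h (hF hx)
      exact P.subset_VI hi hxi
    · apply ENNReal.ofReal_le_ofReal
      rw [P.mem_child h (by omega)] at hyi
      have h2 : 2 * (P.r c k : ℝ) + 1 ≤ i := by exact_mod_cast hi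
      have h3 : P.Lr c k / ((i : ℝ) - 1) ≤ P.Lr c k / (P.r c k : ℝ) / 2 := by
        rw [div_div, mul_comm]
        gcongr
        linarith
      push_cast
      rw [add_sub_cancel_right]
      linarith [hyi.1.2]
  · push Not at hbig
    set p : ℕ → Prop := fun i => P.r c k + 1 ≤ i ∧
      ∃ y ∈ F, y ∈ P.altCyl (Function.update c k i) (k + 1) with hp
    have hlt : ∀ i, p i → i ≤ 2 * P.r c k := by
      rintro i ⟨_, y, hy, hyi⟩
      by_contra hc
      exact hbig i (by omega) y hy hyi
    have hex : ∃ i, p i := by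
      obtain ⟨y, hy⟩ := hne
      obtain ⟨i, hi, hyi⟩ := P.exists_child h (hF hy)
      exact ⟨i, hi, y, hy, hyi⟩
    obtain ⟨i0, hi0⟩ := hex
    have hspec : p (Nat.findGreatest p (2 * P.r c k)) := Nat.findGreatest_spec (hlt i0 hi0) hi0
    have hmax : ∀ i, p i → i ≤ Nat.findGreatest p (2 * P.r c k) :=
      fun i hi => Nat.le_findGreatest (hlt i hi) hi
    generalize Nat.findGreatest p (2 * P.r c k) = m at *
    obtain ⟨hm, y, hy, hym⟩ := hspec
    rcases hm.eq_or_lt with hm' | hm'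
    · subst hm'
      have hsub : F ⊆ P.altCyl (Function.update c k (P.r c k + 1)) (k + 1) := by
        intro x hx
        obtain ⟨i, hi, hxi⟩ := P.exists_child h (hF hx)
        have := hmax i ⟨hi, x, hx, hxi⟩
        have : i = P.r c k + 1 := by omega
        rwa [this] at hxi
      obtain ⟨V, hV, hFV, z, hz, hd⟩ := P.cover_a (P.adm_upd h le_rfl) hne hsub
      refine ⟨V, hV, hFV, z, hz, hd.trans_eq ?_⟩
      rw [pos_upd, hDL]
      push_cast
      rw [add_sub_cancel_right]
    · refine ⟨P.VF c k (P.r c k + 1) m, P.VF_mem h le_rfl hm, ?_, y, hy,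
        (P.VF_diam h le_rfl).trans ?_⟩
      · intro x hx
        obtain ⟨i, hi, hxi⟩ := P.exists_child h (hF hx)
        exact P.subset_VF hi (hmax i ⟨hi, x, hx, hxi⟩) hxi
      · apply ENNReal.ofReal_le_ofReal
        rw [P.mem_child h hm] at hym
        have h2 : (P.r c k : ℝ) + 2 ≤ m := by exact_mod_cast hm'
        push_cast
        rw [add_sub_cancel_right]
        have h3 : 2 * (P.Lr c k / ((m : ℝ) - 1)) ≤ P.Lr c k / (P.r c k : ℝ) + P.Lr c k / m := by
          rw [← mul_div_assoc, div_add_div _ _ (by linarith) (by linarith),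
            div_le_div_iff₀ (by linarith) (by nlinarith)]
          have : 2 * ((P.r c k : ℝ) * m) ≤ (m + P.r c k) * (m - 1) := by nlinarith
          nlinarith
        linarith [hym.1.2]

lemma exists_small (η : ℝ) (hη : 0 < η) : ∃ V ∈ P.famAlt, Metric.ediam V ≤ ENNReal.ofReal η := by
  have h : P.AdmissibleUpTo (fun _ => 0) 0 := fun i hi => absurd hi (by omega)
  have hL := P.Lr_pos h
  obtain ⟨n, hn⟩ := exists_nat_gt (P.Lr (fun _ => 0) 0 / η)
  have hn' : P.r (fun _ => 0) 0 + 1 ≤ P.r (fun _ => 0) 0 + 1 + n := by omega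
  refine ⟨_, P.VI_mem h hn', (P.VI_diam h hn').trans ?_⟩
  apply ENNReal.ofReal_le_ofReal
  have hr : (1 : ℝ) ≤ P.r (fun _ => 0) 0 := by exact_mod_cast P.r_pos _ _
  push_cast
  have hn0 : (0 : ℝ) ≤ n := Nat.cast_nonneg n
  rw [div_lt_iff₀ hη] at hn
  rw [div_le_iff₀ (by linarith)]
  nlinarith

lemma D_le {c : ℕ → ℕ} {k : ℕ} (h : P.AdmissibleUpTo c k) : P.D c k ≤ (1 / 2) ^ k := by
  induction k with
  | zero => simp [D, rprod, qprod]
  | succ k ih =>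
    have h' : P.AdmissibleUpTo c k := fun i hi => h i (by omega)
    have e : P.D c (k + 1) = P.D c k * (P.r c k / (((c k : ℝ) - 1) * c k)) := by
      unfold D rprod qprod
      rw [Finset.prod_range_succ, Finset.prod_range_succ, mul_div_mul_comm]
    have hr : (1 : ℝ) ≤ P.r c k := by exact_mod_cast P.r_pos c k
    have hc : (P.r c k : ℝ) + 1 ≤ c k := by exact_mod_cast h k (by omega)
    rw [e, pow_succ]
    have hD := P.D_pos h'
    apply mul_le_mul (ih h') _ (div_nonneg (by linarith) (by nlinarith)) (by positivity)
    rw [div_le_div_iff₀ (by nlinarith) (by norm_num)]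
    nlinarith

lemma mem_zero {x : ℝ} (hx : x ∈ Ioo (0 : ℝ) 1 \ P.IS) (c : ℕ → ℕ) : x ∈ P.altCyl c 0 := by
  have h : P.AdmissibleUpTo c 0 := fun i hi => absurd hi (by omega)
  rw [P.mem_altCyl h]
  refine ⟨?_, hx.2⟩
  simpa [pos, A, D, rprod, qprod] using hx.1

lemma exists_cyl {x : ℝ} (hx : x ∈ Ioo (0 : ℝ) 1 \ P.IS) (k : ℕ) :
    ∃ c, P.AdmissibleUpTo c k ∧ x ∈ P.altCyl c k := by
  induction k with
  | zero => exact ⟨fun _ => 0, fun i hi => absurd hi (by omega), P.mem_zero hx _⟩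
  | succ k ih =>
    obtain ⟨c, hc, hxc⟩ := ih
    obtain ⟨i, hi, hxi⟩ := P.exists_child hc hxc
    exact ⟨_, P.adm_upd hc hi, hxi⟩

lemma exists_small_mem {x : ℝ} (hx : x ∈ Ioo (0 : ℝ) 1 \ P.IS) (η : ℝ) (hη : 0 < η) :
    ∃ V ∈ P.famAlt, x ∈ V ∧ Metric.ediam V ≤ ENNReal.ofReal η := by
  obtain ⟨k, hk⟩ := exists_pow_lt_of_lt_one hη (by norm_num : (1 / 2 : ℝ) < 1)
  obtain ⟨c, hc, hxc⟩ := P.exists_cyl hx k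
  refine ⟨_, P.VI_mem hc le_rfl, ?_, (P.VI_diam hc le_rfl).trans ?_⟩
  · obtain ⟨i, hi, hxi⟩ := P.exists_child hc hxc
    exact P.subset_VI hi hxi
  · apply ENNReal.ofReal_le_ofReal
    push_cast
    rw [add_sub_cancel_right, ← D_eq]
    exact (P.D_le hc).trans hk.le

lemma exists_split {F : Set ℝ} (hF : F ⊆ Ioo (0 : ℝ) 1 \ P.IS) (hnt : F.Nontrivial) :
    ∃ c k, P.AdmissibleUpTo c k ∧ F ⊆ P.altCyl c k ∧
      ∀ i, P.r c k + 1 ≤ i → ¬ F ⊆ P.altCyl (Function.update c k i) (k + 1) := by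
  by_contra hcon
  push Not at hcon
  have key : ∀ k, ∃ c, P.AdmissibleUpTo c k ∧ F ⊆ P.altCyl c k := by
    intro k
    induction k with
    | zero => exact ⟨fun _ => 0, fun i hi => absurd hi (by omega), fun x hx => P.mem_zero (hF hx) _⟩
    | succ k ih =>
      obtain ⟨c, hc, hFc⟩ := ih
      obtain ⟨i, hi, h⟩ := hcon c k hc hFc
      exact ⟨_, P.adm_upd hc hi, h⟩
  obtain ⟨x, hx, y, hy, hxy⟩ := hnt
  obtain ⟨k, hk⟩ := exists_pow_lt_of_lt_one (abs_pos.2 (sub_ne_zero.2 hxy))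
    (by norm_num : (1 / 2 : ℝ) < 1)
  obtain ⟨c, hc, hFc⟩ := key k
  have h1 := hFc hx
  have h2 := hFc hy
  rw [P.mem_altCyl hc] at h1 h2
  rw [← P.abs_pos_sub c k] at hk
  have := P.D_le hc
  have : |P.pos c k x - P.pos c k y| ≤ P.D c k := by
    rw [abs_le]; constructor <;> linarith [h1.1.1, h1.1.2, h2.1.1, h2.1.2]
  linarith

lemma cover_nontrivial {F : Set ℝ} (hF : F ⊆ Ioo (0 : ℝ) 1 \ P.IS) (hnt : F.Nontrivial)
    (η : ℝ) (hη : 0 < η) :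
    ∃ V₁ ∈ P.famAlt, ∃ V₂ ∈ P.famAlt, ∃ V₃ ∈ P.famAlt, F ⊆ V₁ ∪ V₂ ∪ V₃ ∧
      ∃ y ∈ F, ∃ z ∈ F, Metric.ediam V₁ + Metric.ediam V₂ + Metric.ediam V₃ ≤
        ENNReal.ofReal (2 * |y - z| + η) := by
  classical
  obtain ⟨c, k, h, hFc, hno⟩ := P.exists_split hF hnt
  have hL := P.Lr_pos h
  set p : ℕ → Prop := fun i => P.r c k + 1 ≤ i ∧
      ∃ y ∈ F, y ∈ P.altCyl (Function.update c k i) (k + 1) with hp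
  have hex : ∃ i, p i := by
    obtain ⟨y, hy⟩ := hnt.nonempty
    obtain ⟨i, hi, hyi⟩ := P.exists_child h (hFc hy)
    exact ⟨i, hi, y, hy, hyi⟩
  have hpn : p (Nat.find hex) := Nat.find_spec hex
  have hmin : ∀ i, p i → Nat.find hex ≤ i := fun i h1 => Nat.find_min' hex h1
  generalize Nat.find hex = n at *
  have hn := hpn.1
  have hn2 : (2 : ℝ) ≤ n := by exact_mod_cast P.two_le_of_adm hn
  obtain ⟨V₁, hV₁, hFV₁, y, hy, hd₁⟩ := P.cover_b (P.adm_upd h hn)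
    (F := F ∩ P.altCyl (Function.update c k n) (k + 1)) hpn.2 inter_subset_right
  rw [pos_upd, P.D_upd' c k (P.two_le_of_adm hn)] at hd₁
  have hyn := (P.mem_child h hn y).1 hy.2
  obtain ⟨V₀, hV₀, hd₀⟩ := P.exists_small η hη
  obtain ⟨w, hw, hwn⟩ := not_subset.1 (hno n hn)
  obtain ⟨i₀, hi₀, hwi₀⟩ := P.exists_child h (hFc hw)
  have hpi₀ : p i₀ := ⟨hi₀, w, hw, hwi₀⟩
  have hni₀ : n < i₀ := by
    refine lt_of_le_of_ne (hmin i₀ hpi₀) ?_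
    rintro rfl
    exact hwn hwi₀
  by_cases hbig : ∃ i, 2 * n + 1 ≤ i ∧ p i
  · obtain ⟨i, hi, hri, z, hz, hzi⟩ := hbig
    rw [P.mem_child h hri] at hzi
    have hi2 : 2 * (n : ℝ) + 1 ≤ i := by exact_mod_cast hi
    refine ⟨V₁, hV₁, P.VI c k (n + 1), P.VI_mem h (by omega), V₀, hV₀, ?_, y, hy.1, z, hz, ?_⟩
    · intro x hx
      obtain ⟨j, hj, hxj⟩ := P.exists_child h (hFc hx)
      rcases (hmin j ⟨hj, x, hx, hxj⟩).eq_or_lt with rfl | hlt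
      · exact Or.inl (Or.inl (hFV₁ ⟨hx, hxj⟩))
      · exact Or.inl (Or.inr (P.subset_VI hlt hxj))
    · have hd₂ := P.VI_diam (n := n + 1) h (by omega)
      push_cast at hd₂
      rw [add_sub_cancel_right] at hd₂
      have h3 : P.Lr c k / ((i : ℝ) - 1) ≤ P.Lr c k / n / 2 := by
        rw [div_div, mul_comm]
        gcongr
        linarith
      have h4 : P.pos c k y - P.pos c k z ≤ |y - z| := by
        rw [← P.abs_pos_sub c k]; exact le_abs_self _
      have h5 : 0 < P.Lr c k / n := by positivity
      calc _ ≤ _ := add_le_add (add_le_add hd₁ hd₂) hd₀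
        _ = _ := by
          rw [← ENNReal.ofReal_add, ← ENNReal.ofReal_add]
          · linarith [hyn.1.1]
          · exact hη.le
          · linarith [hyn.1.1]
          · exact h5.le
        _ ≤ _ := by
          apply ENNReal.ofReal_le_ofReal
          linarith [hzi.1.2]
  · push Not at hbig
    have hlt : ∀ i, p i → i ≤ 2 * n := by
      intro i hi
      by_contra hc
      exact hbig i (by omega) hi
    have hpm : p (Nat.findGreatest p (2 * n)) := Nat.findGreatest_spec (hlt i₀ hpi₀) hpi₀
    have hmax : ∀ i, p i → i ≤ Nat.findGreatest p (2 * n) :=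
      fun i hi => Nat.le_findGreatest (hlt i hi) hi
    generalize Nat.findGreatest p (2 * n) = m at *
    have hm := hpm.1
    have hnm : n < m := hni₀.trans_le (hmax i₀ hpi₀)
    obtain ⟨V₃, hV₃, hFV₃, z, hz, hd₃⟩ := P.cover_a (P.adm_upd h hm)
      (F := F ∩ P.altCyl (Function.update c k m) (k + 1)) hpm.2 inter_subset_right
    rw [pos_upd] at hd₃
    have hzm := (P.mem_child h hm z).1 hz.2
    have hnm' : (n : ℝ) + 1 ≤ m := by exact_mod_cast hnm
    have hmid : ∃ V₂ ∈ P.famAlt, (∀ i, n < i → i < m →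
        P.altCyl (Function.update c k i) (k + 1) ⊆ V₂) ∧
        Metric.ediam V₂ ≤ ENNReal.ofReal (P.Lr c k / n - P.Lr c k / ((m : ℝ) - 1) + η) := by
      have h6 : P.Lr c k / ((m : ℝ) - 1) ≤ P.Lr c k / n := by
        gcongr
        linarith
      rcases (show n + 1 ≤ m from hnm).eq_or_lt with he | hlt
      · refine ⟨V₀, hV₀, fun i h1 h2 => absurd h1 (by omega), hd₀.trans ?_⟩
        apply ENNReal.ofReal_le_ofReal
        linarith
      · refine ⟨P.VF c k (n + 1) (m - 1), P.VF_mem h (by omega) (by omega),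
          fun i h1 h2 => P.subset_VF h1 (by omega), (P.VF_diam h (by omega)).trans ?_⟩
        apply ENNReal.ofReal_le_ofReal
        rw [Nat.cast_sub (by omega)]
        push_cast
        rw [add_sub_cancel_right]
        linarith
    obtain ⟨V₂, hV₂, hFV₂, hd₂⟩ := hmid
    refine ⟨V₁, hV₁, V₂, hV₂, V₃, hV₃, ?_, y, hy.1, z, hz.1, ?_⟩
    · intro x hx
      obtain ⟨j, hj, hxj⟩ := P.exists_child h (hFc hx)
      have hpj : p j := ⟨hj, x, hx, hxj⟩
      rcases (hmin j hpj).eq_or_lt with rfl | hlt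
      · exact Or.inl (Or.inl (hFV₁ ⟨hx, hxj⟩))
      · rcases (hmax j hpj).eq_or_lt with rfl | hlt'
        · exact Or.inr (hFV₃ ⟨hx, hxj⟩)
        · exact Or.inl (Or.inr (hFV₂ j hlt hlt' hxj))
    · have h4 : P.pos c k y - P.pos c k z ≤ |y - z| := by
        rw [← P.abs_pos_sub c k]; exact le_abs_self _
      have h6 : P.Lr c k / ((m : ℝ) - 1) ≤ P.Lr c k / n := by
        gcongr
        linarith
      calc _ ≤ _ := add_le_add (add_le_add hd₁ hd₂) hd₃
        _ = _ := by
          rw [← ENNReal.ofReal_add, ← ENNReal.ofReal_add]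
          · linarith [hyn.1.1]
          · linarith [hzm.1.2]
          · linarith [hyn.1.1]
          · linarith
        _ ≤ _ := by
          apply ENNReal.ofReal_le_ofReal
          linarith [hzm.1.2]

lemma cover_main {F : Set ℝ} (hF : F ⊆ Ioo (0 : ℝ) 1 \ P.IS) (η : ℝ) (hη : 0 < η) :
    ∃ V : Fin 3 → Set ℝ, (∀ j, V j ∈ P.famAlt) ∧ F ⊆ ⋃ j, V j ∧
      ∑ j, Metric.ediam (V j) ≤ 3 * max (Metric.ediam F) (ENNReal.ofReal η) := by
  rcases F.subsingleton_or_nontrivial with hs | hnt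
  · have : ∃ V ∈ P.famAlt, F ⊆ V ∧ Metric.ediam V ≤ ENNReal.ofReal η := by
      rcases F.eq_empty_or_nonempty with rfl | ⟨x, hx⟩
      · obtain ⟨V, hV, hd⟩ := P.exists_small η hη
        exact ⟨V, hV, empty_subset _, hd⟩
      · obtain ⟨V, hV, hxV, hd⟩ := P.exists_small_mem (hF hx) η hη
        refine ⟨V, hV, fun y hy => ?_, hd⟩
        rwa [hs hy hx]
    obtain ⟨V, hV, hFV, hd⟩ := this
    refine ⟨fun _ => V, fun _ => hV, fun x hx => mem_iUnion.2 ⟨0, hFV hx⟩, ?_⟩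
    simp only [Finset.sum_const, Finset.card_univ, Fintype.card_fin, nsmul_eq_mul]
    push_cast
    gcongr
    exact hd.trans (le_max_right _ _)
  · obtain ⟨V₁, h₁, V₂, h₂, V₃, h₃, hc, y, hy, z, hz, hd⟩ := P.cover_nontrivial hF hnt η hη
    refine ⟨![V₁, V₂, V₃], ?_, ?_, ?_⟩
    · intro j; fin_cases j <;> assumption
    · intro x hx
      rcases hc hx with (h | h) | h
      · exact mem_iUnion.2 ⟨0, h⟩
      · exact mem_iUnion.2 ⟨1, h⟩
      · exact mem_iUnion.2 ⟨2, h⟩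
    · rw [Fin.sum_univ_three]
      refine hd.trans ?_
      rw [ENNReal.ofReal_add (by positivity) hη.le, ENNReal.ofReal_mul (by norm_num),
        ← Real.dist_eq, ← edist_dist]
      have : edist y z ≤ Metric.ediam F := Metric.edist_le_ediam_of_mem hy hz
      calc _ ≤ 2 * max (Metric.ediam F) (ENNReal.ofReal η) +
            max (Metric.ediam F) (ENNReal.ofReal η) := by
              gcongr
              · simp
              · exact this.trans (le_max_left _ _)
              · exact le_max_right _ _
        _ = _ := by ring

end PerronSystem
/-- the constant -/
noncomputable def powC (α : ℝ) : ℝ≥0∞ := if α ≤ 1 then 3 else 3 * 3 ^ α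

lemma powC_ne_top (α : ℝ) (hα : 0 < α) : powC α ≠ ⊤ := by
  unfold powC
  split_ifs
  · simp
  · exact ENNReal.mul_ne_top (by simp) (ENNReal.rpow_ne_top_of_nonneg hα.le (by simp))

lemma powC_ne_zero (α : ℝ) (hα : 0 < α) : powC α ≠ 0 := by
  unfold powC
  split_ifs
  · simp
  · simp [ENNReal.rpow_eq_zero_iff, hα.le]

lemma sum_pow_le (α : ℝ) (hα : 0 < α) (d : Fin 3 → ℝ≥0∞) (M : ℝ≥0∞) (h : ∑ j, d j ≤ 3 * M) :
    ∑ j, d j ^ α ≤ powC α * M ^ α := by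
  unfold powC
  split_ifs with h1
  · have h3 : (3 : ℝ≥0∞)⁻¹ * 3 = 1 := ENNReal.inv_mul_cancel (by simp) (by simp)
    have key := ENNReal.rpow_arith_mean_le_arith_mean_rpow (Finset.univ : Finset (Fin 3))
      (fun _ => 3⁻¹) (fun j => d j ^ α)
      (by simp only [Finset.sum_const, Finset.card_univ, Fintype.card_fin, nsmul_eq_mul]
          push_cast
          rw [mul_comm, h3])
      (p := α⁻¹) ((one_le_inv₀ hα).2 h1)
    simp only [← Finset.mul_sum, ← ENNReal.rpow_mul, mul_inv_cancel₀ hα.ne', ENNReal.rpow_one]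
      at key
    have h4 : (3 : ℝ≥0∞)⁻¹ * ∑ j, d j ≤ M := by
      calc _ ≤ (3 : ℝ≥0∞)⁻¹ * (3 * M) := by gcongr
        _ = M := by rw [← mul_assoc, h3, one_mul]
    have h5 := key.trans h4
    rw [ENNReal.rpow_inv_le_iff hα] at h5
    calc _ = 3 * (3⁻¹ * ∑ j, d j ^ α) := by rw [← mul_assoc, mul_comm 3, h3, one_mul]
      _ ≤ _ := by gcongr
  · calc ∑ j, d j ^ α ≤ ∑ j : Fin 3, (3 * M) ^ α := by
          gcongr with j
          exact (Finset.single_le_sum (f := d) (fun _ _ => zero_le) (Finset.mem_univ j)).trans h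
      _ = _ := by
        simp only [Finset.sum_const, Finset.card_univ, Fintype.card_fin, nsmul_eq_mul]
        push_cast
        rw [ENNReal.mul_rpow_of_nonneg _ _ hα.le, mul_assoc]

lemma Hfam_ge (Φ : Set (Set ℝ)) (E : Set ℝ) (α : ℝ) : μH[α] E ≤ Hfam Φ α E := by
  rw [Measure.hausdorffMeasure_apply]
  refine iSup₂_le fun r hr => ?_
  obtain ⟨ε, hε, hεr⟩ : ∃ ε : ℝ, 0 < ε ∧ ENNReal.ofReal ε ≤ r := by
    rcases eq_or_ne r ⊤ with rfl | hrt
    · exact ⟨1, one_pos, le_top⟩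
    · exact ⟨r.toReal, ENNReal.toReal_pos hr.ne' hrt, ENNReal.ofReal_toReal_le⟩
  unfold Hfam
  refine le_iSup₂_of_le ε hε ?_
  refine le_iInf fun f => le_iInf fun hf => le_iInf fun _ => le_iInf fun hd => ?_
  refine iInf₂_le_of_le f hf (iInf_le_of_le (fun n => (hd n).trans hεr) ?_)
  exact ENNReal.tsum_le_tsum fun n => iSup_le fun _ => le_rfl

lemma Hfam_le (P : PerronSystem) {E : Set ℝ} (hE : E ⊆ Set.Ioo 0 1 \ P.IS) (α : ℝ) (hα : 0 < α) :
    Hfam P.famAlt α E ≤ powC α * μH[α] E := by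
  have hC0 := powC_ne_zero α hα
  have hCt := powC_ne_top α hα
  rcases eq_or_ne (μH[α] E) ⊤ with htop | htop
  · rw [htop, ENNReal.mul_top hC0]; exact le_top
  unfold Hfam
  refine iSup₂_le fun ε hε => ?_
  have hstep : ∀ δ : ℝ≥0∞, δ ≠ 0 → δ ≠ ⊤ →
      (⨅ (f : ℕ → Set ℝ) (_ : E ⊆ ⋃ n, f n) (_ : ∀ n, f n ∈ P.famAlt)
      (_ : ∀ n, Metric.ediam (f n) ≤ ENNReal.ofReal ε),
      ∑' n : ℕ, Metric.ediam (f n) ^ α) ≤ powC α * ((μH[α] E + δ) + δ) := by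
    intro δ hδ hδt
    have hε3 : 0 < ε / 3 := by positivity
    have hlt : (⨅ (t : ℕ → Set ℝ) (_ : E ⊆ ⋃ n, t n)
        (_ : ∀ n, Metric.ediam (t n) ≤ ENNReal.ofReal (ε / 3)),
          ∑' n, ⨆ _ : (t n).Nonempty, Metric.ediam (t n) ^ α) < μH[α] E + δ := by
      refine lt_of_le_of_lt ?_ (ENNReal.lt_add_right htop hδ)
      rw [Measure.hausdorffMeasure_apply]
      exact le_iSup₂_of_le (ENNReal.ofReal (ε / 3)) (ENNReal.ofReal_pos.2 hε3) le_rfl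
    simp only [iInf_lt_iff] at hlt
    obtain ⟨t, hEt, htd, hts⟩ := hlt
    obtain ⟨δ', hδ'0, hδ's⟩ := ENNReal.exists_pos_sum_of_countable hδ ℕ
    set η : ℕ → ℝ := fun n => min (ε / 3) ((δ' n : ℝ) ^ α⁻¹) with hη
    have hη0 : ∀ n, 0 < η n := fun n =>
      lt_min hε3 (Real.rpow_pos_of_pos (by exact_mod_cast hδ'0 n) _)
    have hηp : ∀ n, ENNReal.ofReal (η n) ^ α ≤ δ' n := by
      intro n
      rw [ENNReal.ofReal_rpow_of_pos (hη0 n), ← ENNReal.ofReal_coe_nnreal]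
      apply ENNReal.ofReal_le_ofReal
      calc η n ^ α ≤ ((δ' n : ℝ) ^ α⁻¹) ^ α :=
            Real.rpow_le_rpow (hη0 n).le (min_le_right _ _) hα.le
        _ = δ' n := by rw [← Real.rpow_mul (by positivity), inv_mul_cancel₀ hα.ne', Real.rpow_one]
    have hcov := fun n => P.cover_main (F := t n ∩ E) (inter_subset_right.trans hE) (η n) (hη0 n)
    choose V hVm hVc hVd using hcov
    let e := Nat.divModEquiv 3
    refine iInf_le_of_le (fun m => V (e m).1 (e m).2) (iInf_le_of_le ?_ (iInf_le_of_le ?_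
      (iInf_le_of_le ?_ ?_)))
    · intro x hx
      obtain ⟨n, hn⟩ := mem_iUnion.1 (hEt hx)
      obtain ⟨j, hj⟩ := mem_iUnion.1 (hVc n ⟨hn, hx⟩)
      refine mem_iUnion.2 ⟨e.symm (n, j), ?_⟩
      rw [Equiv.apply_symm_apply]
      exact hj
    · exact fun m => hVm _ _
    · intro m
      show Metric.ediam (V (e m).1 (e m).2) ≤ ENNReal.ofReal ε
      generalize (e m).1 = n
      generalize (e m).2 = j
      calc Metric.ediam (V n j) ≤ ∑ j, Metric.ediam (V n j) :=
            Finset.single_le_sum (f := fun j => Metric.ediam (V n j)) (fun _ _ => zero_le)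
              (Finset.mem_univ j)
        _ ≤ _ := hVd n
        _ ≤ 3 * ENNReal.ofReal (ε / 3) := by
          gcongr
          apply max_le
          · exact (Metric.ediam_mono inter_subset_left).trans (htd n)
          · exact ENNReal.ofReal_le_ofReal (min_le_left _ _)
        _ = ENNReal.ofReal ε := by
          rw [show (3 : ℝ≥0∞) = ENNReal.ofReal 3 by simp, ← ENNReal.ofReal_mul (by norm_num)]
          congr 1
          ring
    · have hE1 : ∑' m, Metric.ediam (V (e m).1 (e m).2) ^ α =
          ∑' n, ∑ j, Metric.ediam (V n j) ^ α := by
        rw [e.tsum_eq (fun q : ℕ × Fin 3 => Metric.ediam (V q.1 q.2) ^ α), 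
          ENNReal.tsum_prod (f := fun n j => Metric.ediam (V n j) ^ α)]
        simp only [tsum_fintype]
      rw [hE1]
      calc _ ≤ ∑' n, powC α * ((⨆ _ : (t n).Nonempty, Metric.ediam (t n) ^ α) + δ' n) := by
            refine ENNReal.tsum_le_tsum fun n => ?_
            refine (sum_pow_le α hα _ _ (hVd n)).trans ?_
            gcongr
            have h1 : Metric.ediam (t n ∩ E) ^ α ≤
                ⨆ _ : (t n).Nonempty, Metric.ediam (t n) ^ α := by
              rcases (t n).eq_empty_or_nonempty with h0 | h0
              · simp [h0, hα]
              · refine le_iSup_of_le h0 ?_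
                gcongr
                exact inter_subset_left
            rcases max_choice (Metric.ediam (t n ∩ E)) (ENNReal.ofReal (η n)) with h2 | h2 <;>
              rw [h2]
            · exact h1.trans le_self_add
            · exact (hηp n).trans le_add_self
        _ = powC α * ((∑' n, ⨆ _ : (t n).Nonempty, Metric.ediam (t n) ^ α) + ∑' n, (δ' n : ℝ≥0∞)) := by
            rw [ENNReal.tsum_mul_left, ENNReal.tsum_add]
        _ ≤ _ := by gcongr
  refine ENNReal.le_of_forall_pos_le_add fun δ hδ _ => ?_
  have hδ' : (δ : ℝ≥0∞) / (2 * powC α) ≠ 0 := by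
    apply ENNReal.div_ne_zero.2
    exact ⟨by exact_mod_cast hδ.ne', ENNReal.mul_ne_top (by simp) hCt⟩
  have hδt : (δ : ℝ≥0∞) / (2 * powC α) ≠ ⊤ :=
    ENNReal.div_ne_top (by simp) (mul_ne_zero (by simp) hC0)
  refine (hstep _ hδ' hδt).trans_eq ?_
  rw [add_assoc, mul_add, ← two_mul, ← mul_assoc, mul_comm (powC α) 2,
    ENNReal.mul_div_cancel (mul_ne_zero (by simp) hC0) (ENNReal.mul_ne_top (by simp) hCt)]

lemma muH_zero_of_one_lt (E : Set ℝ) (α : ℝ) (hα : 1 < α) : μH[α] E = 0 := by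
  have h : dimH E < (α.toNNReal : ℝ≥0∞) := by
    refine lt_of_le_of_lt ((dimH_mono (subset_univ E)).trans_eq Real.dimH_univ) ?_
    rw [← ENNReal.ofReal, ← ENNReal.ofReal_one]
    exact (ENNReal.ofReal_lt_ofReal_iff (by linarith)).2 hα
  have := hausdorffMeasure_of_dimH_lt h
  rwa [Real.coe_toNNReal _ (by linarith)] at this

/-- For every `E ⊆ (0,1) \ IS^{P⁻}` and `α > 0`,
`H^α(E) ≤ H^α(E,𝔓⁻) ≤ 3·H^α(E)`; consequently `𝔓⁻` is a faithful family of coverings for the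
Hausdorff dimension calculation on `(0,1) \ IS^{P⁻}`. -/
theorem famAlt_faithful (P : PerronSystem) :
    (∀ E : Set ℝ, E ⊆ Set.Ioo 0 1 \ P.IS → ∀ α : ℝ, 0 < α →
      μH[α] E ≤ Hfam P.famAlt α E ∧ Hfam P.famAlt α E ≤ 3 * μH[α] E) ∧
    (∀ E : Set ℝ, E ⊆ Set.Ioo 0 1 \ P.IS → dimFam P.famAlt E = dimH E) := by
  have h1 : ∀ E : Set ℝ, E ⊆ Set.Ioo 0 1 \ P.IS → ∀ α : ℝ, 0 < α →
      μH[α] E ≤ Hfam P.famAlt α E ∧ Hfam P.famAlt α E ≤ 3 * μH[α] E := by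
    intro E hE α hα
    refine ⟨Hfam_ge _ _ _, (Hfam_le P hE α hα).trans ?_⟩
    rcases le_or_gt α 1 with h | h
    · simp [powC, h]
    · simp [muH_zero_of_one_lt E α h]
  refine ⟨h1, fun E hE => le_antisymm ?_ ?_⟩
  · refine le_of_forall_gt_imp_ge_of_dense fun a ha => ?_
    rcases eq_or_ne a ⊤ with rfl | hat
    · exact le_top
    lift a to NNReal using hat
    have h0 := hausdorffMeasure_of_dimH_lt ha
    have ha0 : (0 : ℝ) < a := by exact_mod_cast (zero_le.trans_lt ha : (0 : ℝ≥0∞) < a)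
    unfold dimFam
    refine iInf_le_of_le (a : ℝ) (iInf_le_of_le ha0 (iInf_le_of_le ?_ ?_))
    · have := (h1 E hE a ha0).2
      rw [h0, mul_zero] at this
      exact le_antisymm this zero_le
    · simp
  · unfold dimFam
    refine le_iInf fun α => le_iInf fun hα => le_iInf fun h0 => ?_
    have h2 := (h1 E hE α hα).1
    rw [h0] at h2
    apply dimH_le_of_hausdorffMeasure_ne_top
    rw [Real.coe_toNNReal _ hα.le]
    exact (h2.trans_lt ENNReal.zero_lt_top).ne
end

section
/- Let P be a Perron system, 𝔓 the associated family of unions of consecutive P-cylinders, and 𝔓₁ ⊆ 𝔓 the subfamily of all finite unions of consecutive P-cylinders of the same rank contained in a single P-cylinder of the previous rank (i.e. the unions with m < ∞). Then H^α(E, 𝔓₁) = H^α(E, 𝔓) for every set E ⊆ (0,1] and every α > 0, and 𝔓₁ is a faithful family of coverings for the Hausdorff dimension calculation on (0,1]. -/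
open Set Filter MeasureTheory
open scoped ENNReal

namespace PerronAux

open PerronSystem Metric

lemma Hfam_eq (Φ : Set (Set ℝ)) (α : ℝ) (E : Set ℝ) : Hfam Φ α E =
  ⨆ (ε : ℝ) (_ : 0 < ε),
    ⨅ (f : ℕ → Set ℝ) (_ : E ⊆ ⋃ n, f n) (_ : ∀ n, f n ∈ Φ)
      (_ : ∀ n, ediam (f n) ≤ ENNReal.ofReal ε),
      ∑' n : ℕ, ediam (f n) ^ α := rfl

/-- comparison of covering families -/
lemma Hfam_le_mul {Φ Ψ : Set (Set ℝ)} {α : ℝ} {C : ℝ≥0∞} (hC0 : C ≠ 0) (hC : C ≠ ⊤)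
    (H : ∀ U ∈ Ψ, ∀ ε : ℝ, 0 < ε → ediam U ≤ ENNReal.ofReal ε → ∀ δ : ℝ≥0∞, 0 < δ →
      ∃ g : ℕ → Set ℝ, (∀ j, g j ∈ Φ) ∧ U ⊆ ⋃ j, g j ∧
        (∀ j, ediam (g j) ≤ ENNReal.ofReal (2 * ε)) ∧
        ∑' j, ediam (g j) ^ α ≤ C * ediam U ^ α + δ) (E : Set ℝ) :
    Hfam Φ α E ≤ C * Hfam Ψ α E := by
  rw [Hfam_eq, Hfam_eq]
  refine iSup₂_le fun ε hε => ?_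
  rw [mul_comm, ← ENNReal.div_le_iff_le_mul (.inl hC0) (.inl hC)]
  refine le_iSup₂_of_le (ε / 2) (by positivity) ?_
  refine le_iInf fun f => le_iInf fun hE => le_iInf fun hf => le_iInf fun hd => ?_
  rw [ENNReal.div_le_iff_le_mul (.inl hC0) (.inl hC), mul_comm]
  refine ENNReal.le_of_forall_pos_le_add fun δ hδ _ => ?_
  obtain ⟨δ', hδ', hsum⟩ := ENNReal.exists_pos_sum_of_countable'
    (ε := (δ : ℝ≥0∞)) (by simpa using hδ.ne') ℕ
  have := fun n => H (f n) (hf n) (ε / 2) (by positivity) (hd n) (δ' n) (hδ' n)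
  choose g hg1 hg2 hg3 hg4 using this
  refine iInf_le_of_le (fun k => g (Nat.unpair k).1 (Nat.unpair k).2) ?_
  refine iInf_le_of_le ?_ ?_
  · intro x hx
    obtain ⟨n, hn⟩ := mem_iUnion.1 (hE hx)
    obtain ⟨j, hj⟩ := mem_iUnion.1 (hg2 n hn)
    refine mem_iUnion.2 ⟨Nat.pair n j, ?_⟩
    simpa using hj
  refine iInf_le_of_le (fun k => hg1 _ _) ?_
  refine iInf_le_of_le (fun k => (hg3 _ _).trans (by rw [mul_div_cancel₀]; norm_num)) ?_
  have e : ∑' k, ediam (g (Nat.unpair k).1 (Nat.unpair k).2) ^ α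
      = ∑' (n) (j), ediam (g n j) ^ α := by
    rw [← ENNReal.tsum_prod]
    exact Nat.pairEquiv.symm.tsum_eq (fun p : ℕ × ℕ => ediam (g p.1 p.2) ^ α)
  rw [e]
  calc _ ≤ ∑' n, (C * ediam (f n) ^ α + δ' n) := ENNReal.tsum_le_tsum hg4
    _ = C * ∑' n, ediam (f n) ^ α + ∑' n, δ' n := by
      rw [ENNReal.tsum_add, ENNReal.tsum_mul_left]
    _ ≤ _ := by gcongr

lemma Hfam_anti {Φ Ψ : Set (Set ℝ)} (h : Φ ⊆ Ψ) (α : ℝ) (E : Set ℝ) :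
    Hfam Ψ α E ≤ Hfam Φ α E := by
  rw [Hfam_eq, Hfam_eq]
  refine iSup₂_mono fun ε hε => le_iInf fun f => le_iInf fun hE => le_iInf fun hf =>
    le_iInf fun hd => ?_
  exact iInf_le_of_le f (iInf_le_of_le hE (iInf_le_of_le (fun n => h (hf n))
    (iInf_le_of_le hd le_rfl)))

lemma hausdorff_le_Hfam (Φ : Set (Set ℝ)) (α : ℝ) (E : Set ℝ) :
    Measure.hausdorffMeasure α E ≤ Hfam Φ α E := by
  rw [Hfam_eq, Measure.hausdorffMeasure_apply]
  refine iSup₂_le fun ε hε => ?_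
  obtain ⟨e, he0, he⟩ : ∃ e : ℝ, 0 < e ∧ ENNReal.ofReal e ≤ ε := by
    obtain ⟨x, hx0, hx⟩ := ENNReal.lt_iff_exists_nnreal_btwn.1 hε
    exact ⟨x, by simpa using hx0, by simpa using hx.le⟩
  refine le_iSup₂_of_le e he0 ?_
  refine le_iInf fun f => le_iInf fun hE => le_iInf fun hf => le_iInf fun hd => ?_
  refine iInf_le_of_le f (iInf_le_of_le hE (iInf_le_of_le (fun n => (hd n).trans he) ?_))
  exact ENNReal.tsum_le_tsum fun n => iSup_le fun _ => le_rfl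

lemma Hfam_le_hausdorff {α : ℝ} (hα : 0 < α) {E : Set ℝ} (hE : E ⊆ Ioc 0 1) :
    Hfam {V | V ⊆ Ioc (0:ℝ) 1} α E ≤ Measure.hausdorffMeasure α E := by
  rw [Hfam_eq, Measure.hausdorffMeasure_apply]
  refine iSup₂_le fun ε hε => ?_
  refine le_iSup₂_of_le (ENNReal.ofReal ε) (by simpa using hε) ?_
  refine le_iInf fun f => le_iInf fun hf => le_iInf fun hd => ?_
  refine iInf_le_of_le (fun n => f n ∩ Ioc 0 1) ?_
  refine iInf_le_of_le ?_ (iInf_le_of_le (fun n => inter_subset_right)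
    (iInf_le_of_le (fun n => (ediam_mono inter_subset_left).trans (hd n)) ?_))
  · intro x hx
    obtain ⟨n, hn⟩ := mem_iUnion.1 (hf hx)
    exact mem_iUnion.2 ⟨n, hn, hE hx⟩
  refine ENNReal.tsum_le_tsum fun n => ?_
  rcases (f n).eq_empty_or_nonempty with h | h
  · simp [h, hα]
  · refine le_iSup_of_le h ?_
    exact ENNReal.rpow_le_rpow (ediam_mono inter_subset_left) hα.le

variable (P : PerronSystem)

lemma r_pos (c k) : (1:ℝ) ≤ P.r c k := by
  have := P.φ_pos (List.ofFn fun j : Fin k => c j)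
  exact_mod_cast this

lemma r_update (c : ℕ → ℕ) (k i : ℕ) {j : ℕ} (h : j ≤ k) :
    P.r (Function.update c k i) j = P.r c j := by
  unfold PerronSystem.r
  congr 2
  funext l
  exact Function.update_of_ne (by omega) _ _

lemma rprod_update (c : ℕ → ℕ) (k i : ℕ) {j : ℕ} (h : j ≤ k + 1) :
    P.rprod (Function.update c k i) j = P.rprod c j := by
  unfold rprod
  refine Finset.prod_congr rfl fun l hl => ?_
  rw [r_update]
  have := Finset.mem_range.1 hl
  omega

lemma qprod_update (c : ℕ → ℕ) (k i : ℕ) {j : ℕ} (h : j ≤ k) :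
    qprod (Function.update c k i) j = qprod c j := by
  unfold qprod
  refine Finset.prod_congr rfl fun l hl => ?_
  have := Finset.mem_range.1 hl
  rw [Function.update_of_ne (by omega)]

lemma adm_update {c : ℕ → ℕ} {k i : ℕ} (h : P.AdmissibleUpTo c k) (hi : P.r c k + 1 ≤ i) :
    P.AdmissibleUpTo (Function.update c k i) (k + 1) := by
  intro j hj
  rw [r_update _ _ _ _ (by omega)]
  rcases Nat.lt_succ_iff_lt_or_eq.1 hj with h1 | rfl
  · rw [Function.update_of_ne (by omega)]; exact h j h1
  · simpa using hi

lemma qprod_pos {c : ℕ → ℕ} {k : ℕ} (h : P.AdmissibleUpTo c k) : 0 < qprod c k := by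
  refine Finset.prod_pos fun i hi => ?_
  have h1 := h i (Finset.mem_range.1 hi)
  have h2 := r_pos P c i
  have h3 : (P.r c i : ℝ) + 1 ≤ c i := by exact_mod_cast h1
  have : (0:ℝ) < (c i : ℝ) - 1 := by linarith
  have : (0:ℝ) < (c i : ℝ) := by linarith
  positivity

lemma D_pos {c : ℕ → ℕ} {k : ℕ} (h : P.AdmissibleUpTo c k) : 0 < P.D c k := by
  refine div_pos (Finset.prod_pos fun i _ => ?_) (qprod_pos P h)
  have := r_pos P c i
  linarith

lemma S_update {c : ℕ → ℕ} {k : ℕ} (i : ℕ) :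
    P.S (Function.update c k i) (k + 1) = P.S c k + P.D c k * P.r c k / i := by
  unfold PerronSystem.S PerronSystem.D
  rw [Finset.sum_range_succ]
  congr 1
  · refine Finset.sum_congr rfl fun l hl => ?_
    have := Finset.mem_range.1 hl
    rw [rprod_update _ _ _ _ (by omega), qprod_update _ _ _ (by omega),
      Function.update_of_ne (by omega)]
  · rw [rprod_update _ _ _ _ le_rfl, qprod_update _ _ _ le_rfl, Function.update_self]
    unfold rprod
    rw [Finset.prod_range_succ, ← div_div]
    ring

lemma D_update {c : ℕ → ℕ} {k : ℕ} (i : ℕ) :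
    P.D (Function.update c k i) (k + 1) = P.D c k * P.r c k / (((i:ℝ) - 1) * i) := by
  unfold PerronSystem.D
  rw [rprod_update _ _ _ _ le_rfl]
  unfold qprod rprod
  rw [Finset.prod_range_succ, Finset.prod_range_succ]
  have := qprod_update c k i le_rfl
  unfold qprod at this
  rw [this, Function.update_self]
  rw [← div_div]
  ring

/-- right end of a subcylinder -/
lemma SD_update {c : ℕ → ℕ} {k : ℕ} {i : ℕ} (hi : P.r c k + 1 ≤ i) :
    P.S (Function.update c k i) (k + 1) + P.D (Function.update c k i) (k + 1)
      = P.S c k + P.D c k * P.r c k / ((i:ℝ) - 1) := by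
  rw [S_update, D_update]
  have h2 := r_pos P c k
  have h3 : (P.r c k : ℝ) + 1 ≤ i := by exact_mod_cast hi
  have : (i:ℝ) - 1 ≠ 0 := by linarith
  have : (i:ℝ) ≠ 0 := by linarith
  field_simp
  ring

lemma cyl_update {c : ℕ → ℕ} {k : ℕ} {i : ℕ} (hi : P.r c k + 1 ≤ i) :
    P.cyl (Function.update c k i) (k + 1) =
      Ioc (P.S c k + P.D c k * P.r c k / i) (P.S c k + P.D c k * P.r c k / ((i:ℝ) - 1)) := by
  unfold cyl
  rw [SD_update P hi, S_update]

lemma D_half {c : ℕ → ℕ} {k : ℕ} (h : P.AdmissibleUpTo c k) {i : ℕ} (hi : P.r c k + 1 ≤ i) :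
    P.D (Function.update c k i) (k + 1) ≤ P.D c k / 2 := by
  rw [D_update]
  have h1 := D_pos P h
  have h2 := r_pos P c k
  have h3 : (P.r c k : ℝ) + 1 ≤ i := by exact_mod_cast hi
  have h4 : (0:ℝ) < (i:ℝ) - 1 := by linarith
  have h5 : (0:ℝ) < (i:ℝ) := by linarith
  rw [div_le_div_iff₀ (by positivity) (by norm_num), mul_assoc]
  refine mul_le_mul_of_nonneg_left ?_ h1.le
  nlinarith

/-- digit of a point -/
lemma exists_digit {c : ℕ → ℕ} {k : ℕ} (h : P.AdmissibleUpTo c k) {x : ℝ} (hx : x ∈ P.cyl c k) :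
    ∃ p, P.r c k + 1 ≤ p ∧ P.S c k + P.D c k * P.r c k / p < x ∧
      x ≤ P.S c k + P.D c k * P.r c k / ((p:ℝ) - 1) := by
  obtain ⟨hx1, hx2⟩ := hx
  have h1 := D_pos P h
  have h2 := r_pos P c k
  have hy : 0 < x - P.S c k := by linarith
  set t := P.D c k * P.r c k / (x - P.S c k) with ht
  have ht1 : (P.r c k : ℝ) ≤ t := by
    rw [ht, le_div_iff₀ hy, mul_comm]
    refine mul_le_mul_of_nonneg_right (by linarith) (by linarith)
  have ht0 : 0 ≤ t := by linarith
  have hf : P.r c k ≤ ⌊t⌋₊ := Nat.le_floor ht1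
  have hf1 := Nat.floor_le ht0
  have hf2 := Nat.lt_floor_add_one t
  have hf' : (P.r c k : ℝ) ≤ ⌊t⌋₊ := by exact_mod_cast hf
  have htt : P.D c k * P.r c k = t * (x - P.S c k) := by rw [ht]; field_simp
  refine ⟨⌊t⌋₊ + 1, by omega, ?_, ?_⟩
  · push_cast
    have : P.D c k * P.r c k / ((⌊t⌋₊ : ℝ) + 1) < x - P.S c k := by
      rw [div_lt_iff₀ (by positivity), htt, mul_comm]
      exact mul_lt_mul_of_pos_left hf2 hy
    linarith
  · push_cast
    have : x - P.S c k ≤ P.D c k * P.r c k / ((⌊t⌋₊ : ℝ) + 1 - 1) := by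
      rw [add_sub_cancel_right, le_div_iff₀ (by linarith), htt, mul_comm]
      exact mul_le_mul_of_nonneg_right hf1 hy.le
    linarith

/-- monotonicity of endpoints -/
lemma end_mono {c : ℕ → ℕ} {k : ℕ} (h : P.AdmissibleUpTo c k) {a b : ℝ} (ha : 0 < a)
    (hab : a ≤ b) : P.S c k + P.D c k * P.r c k / b ≤ P.S c k + P.D c k * P.r c k / a := by
  have h1 := D_pos P h
  have h2 := r_pos P c k
  gcongr

lemma cyl_sub {c : ℕ → ℕ} {k : ℕ} (h : P.AdmissibleUpTo c k) {i : ℕ} (hi : P.r c k + 1 ≤ i) :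
    P.S c k + P.D c k * P.r c k / ((i:ℝ) - 1) ≤ P.S c k + P.D c k := by
  have h1 := D_pos P h
  have h2 := r_pos P c k
  have h3 : (P.r c k : ℝ) + 1 ≤ i := by exact_mod_cast hi
  have := end_mono P h (a := P.r c k) (b := (i:ℝ) - 1) (by linarith) (by linarith)
  rwa [mul_div_cancel_right₀ _ (by linarith)] at this

lemma union_inf {c : ℕ → ℕ} {k n : ℕ} (h : P.AdmissibleUpTo c k) (hn : P.r c k + 1 ≤ n) :
    (⋃ i ∈ {j : ℕ | n ≤ j}, P.cyl (Function.update c k i) (k + 1)) =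
      Ioc (P.S c k) (P.S c k + P.D c k * P.r c k / ((n:ℝ) - 1)) := by
  have h1 := D_pos P h
  have h2 := r_pos P c k
  have h3 : (P.r c k : ℝ) + 1 ≤ n := by exact_mod_cast hn
  ext x
  simp only [mem_iUnion, mem_setOf_eq, exists_prop]
  constructor
  · rintro ⟨i, hi, hx⟩
    rw [cyl_update P (hn.trans hi)] at hx
    have hi' : (n:ℝ) ≤ i := by exact_mod_cast hi
    refine ⟨lt_of_le_of_lt ?_ hx.1, hx.2.trans (end_mono P h (by linarith) (by linarith))⟩
    have : 0 ≤ P.D c k * P.r c k / i := by positivity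
    linarith
  · rintro ⟨hx1, hx2⟩
    obtain ⟨p, hp, hp1, hp2⟩ := exists_digit P h (x := x) ⟨hx1, hx2.trans (cyl_sub P h hn)⟩
    refine ⟨p, ?_, by rw [cyl_update P hp]; exact ⟨hp1, hp2⟩⟩
    by_contra hlt
    have h4 : (p:ℝ) ≤ (n:ℝ) - 1 := by
      have : p + 1 ≤ n := by omega
      have : (p:ℝ) + 1 ≤ n := by exact_mod_cast this
      linarith
    have h5 : (P.r c k : ℝ) + 1 ≤ p := by exact_mod_cast hp
    have := end_mono P h (a := p) (b := (n:ℝ) - 1) (by linarith) h4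
    linarith

lemma union_fin {c : ℕ → ℕ} {k n m : ℕ} (h : P.AdmissibleUpTo c k) (hn : P.r c k + 1 ≤ n)
    (hnm : n ≤ m) :
    (⋃ i ∈ Finset.Icc n m, P.cyl (Function.update c k i) (k + 1)) =
      Ioc (P.S c k + P.D c k * P.r c k / m) (P.S c k + P.D c k * P.r c k / ((n:ℝ) - 1)) := by
  have h1 := D_pos P h
  have h2 := r_pos P c k
  have h3 : (P.r c k : ℝ) + 1 ≤ n := by exact_mod_cast hn
  ext x
  simp only [mem_iUnion, Finset.mem_Icc, exists_prop]
  constructor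
  · rintro ⟨i, ⟨hi, him⟩, hx⟩
    rw [cyl_update P (hn.trans hi)] at hx
    have hi' : (n:ℝ) ≤ i := by exact_mod_cast hi
    have him' : (i:ℝ) ≤ m := by exact_mod_cast him
    exact ⟨lt_of_le_of_lt (end_mono P h (by linarith) him') hx.1,
      hx.2.trans (end_mono P h (by linarith) (by linarith))⟩
  · rintro ⟨hx1, hx2⟩
    have hx0 : P.S c k < x := by
      have : 0 ≤ P.D c k * P.r c k / m := by positivity
      linarith
    have hx : x ∈ ⋃ i ∈ {j : ℕ | n ≤ j}, P.cyl (Function.update c k i) (k + 1) := by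
      rw [union_inf P h hn]; exact ⟨hx0, hx2⟩
    simp only [mem_iUnion, mem_setOf_eq, exists_prop] at hx
    obtain ⟨i, hi, hx⟩ := hx
    refine ⟨i, ⟨hi, ?_⟩, hx⟩
    rw [cyl_update P (hn.trans hi)] at hx
    by_contra hlt
    have hm : m + 1 ≤ i := by omega
    have hm' : (m:ℝ) + 1 ≤ i := by exact_mod_cast hm
    have hm0' : (0:ℝ) < m := by
      have : 0 < m := by omega
      exact_mod_cast this
    have := end_mono P h (a := m) (b := (i:ℝ) - 1) hm0' (by linarith)
    linarith [hx.2]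

lemma mem_famP1 {c : ℕ → ℕ} {k n m : ℕ} (h : P.AdmissibleUpTo c k) (hn : P.r c k + 1 ≤ n)
    (hnm : n ≤ m) :
    Ioc (P.S c k + P.D c k * P.r c k / m) (P.S c k + P.D c k * P.r c k / ((n:ℝ) - 1)) ∈ P.famP1 :=
  ⟨c, k, n, m, h, hn, hnm, (union_fin P h hn hnm).symm⟩

lemma famP1_sub : P.famP1 ⊆ P.famP := by
  rintro U ⟨c, k, n, m, h, hn, hnm, hU⟩
  exact ⟨c, k, n, h, hn, .inl ⟨m, hnm, hU⟩⟩

lemma mem_famP {c : ℕ → ℕ} {k n : ℕ} (h : P.AdmissibleUpTo c k) (hn : P.r c k + 1 ≤ n) :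
    Ioc (P.S c k) (P.S c k + P.D c k * P.r c k / ((n:ℝ) - 1)) ∈ P.famP :=
  ⟨c, k, n, h, hn, .inr (union_inf P h hn).symm⟩

lemma cyl_mem_famP {c : ℕ → ℕ} {k : ℕ} (h : P.AdmissibleUpTo c k) : P.cyl c k ∈ P.famP := by
  have := mem_famP P h (n := P.r c k + 1) le_rfl
  have h2 := r_pos P c k
  push_cast at this
  rw [add_sub_cancel_right, mul_div_cancel_right₀ _ (by linarith)] at this
  exact this

lemma blocks {c : ℕ → ℕ} {k : ℕ} (h : P.AdmissibleUpTo c k) (N : ℕ) {α : ℝ} (hα : 0 < α)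
    {ε δ : ℝ≥0∞} (hε : 0 < ε) (hδ : 0 < δ) :
    ∃ M, N ≤ M ∧ ∃ g : ℕ → Set ℝ, (∀ j, g j ∈ P.famP1) ∧
      Ioc (P.S c k) (P.S c k + P.D c k * P.r c k / M) ⊆ ⋃ j, g j ∧
      (∀ j, ediam (g j) ≤ ε) ∧ ∑' j, ediam (g j) ^ α ≤ δ := by
  have h1 := D_pos P h
  have h2 := r_pos P c k
  obtain ⟨δ', hδ', hsum⟩ := ENNReal.exists_pos_sum_of_countable' hδ.ne' ℕ
  have T0 : Tendsto (fun m : ℕ => P.D c k * P.r c k / (m:ℝ)) atTop (nhds 0) :=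
    tendsto_const_div_atTop_nhds_zero_nat _
  have T1 : Tendsto (fun m : ℕ => ENNReal.ofReal (P.D c k * P.r c k / m)) atTop (nhds 0) := by
    simpa using ENNReal.tendsto_ofReal T0
  have T2 : Tendsto (fun m : ℕ => ENNReal.ofReal (P.D c k * P.r c k / m) ^ α) atTop (nhds 0) := by
    have := (ENNReal.continuous_rpow_const (y := α)).tendsto 0
    rw [ENNReal.zero_rpow_of_pos hα] at this
    exact this.comp T1
  obtain ⟨φ, hφ, hp⟩ := extraction_forall_of_eventually
    (P := fun j m => (N ≤ m ∧ P.r c k ≤ m) ∧ ENNReal.ofReal (P.D c k * P.r c k / m) ≤ ε ∧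
      ENNReal.ofReal (P.D c k * P.r c k / m) ^ α ≤ δ' j) (by
      intro j
      exact ((eventually_ge_atTop N).and (eventually_ge_atTop _)).and
        ((T1.eventually_le_const hε).and (T2.eventually_le_const (hδ' j))))
  have hd : ∀ j, ediam (Ioc (P.S c k + P.D c k * P.r c k / (φ (j+1)))
      (P.S c k + P.D c k * P.r c k / (φ j))) ≤ ENNReal.ofReal (P.D c k * P.r c k / φ j) := by
    intro j
    rw [Real.ediam_Ioc]
    apply ENNReal.ofReal_le_ofReal
    have : 0 ≤ P.D c k * P.r c k / φ (j+1) := by positivity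
    linarith
  refine ⟨φ 0, (hp 0).1.1, fun j => Ioc (P.S c k + P.D c k * P.r c k / (φ (j+1)))
      (P.S c k + P.D c k * P.r c k / (φ j)), ?_, ?_, ?_, ?_⟩
  · intro j
    have := mem_famP1 P h (n := φ j + 1) (m := φ (j+1)) (by have := (hp j).1.2; omega)
      (hφ (Nat.lt_succ_self j))
    simpa using this
  · rintro x ⟨hx1, hx2⟩
    have T3 := (T0.comp hφ.tendsto_atTop).eventually_lt_const (sub_pos.2 hx1)
    have hex : ∃ j, P.S c k + P.D c k * P.r c k / φ j < x := by
      obtain ⟨j, hj⟩ := T3.exists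
      refine ⟨j, ?_⟩
      simp only [Function.comp] at hj
      linarith
    classical
    have hs := Nat.find_spec hex
    have hm := fun j => Nat.find_min (m := j) hex
    rcases hj : Nat.find hex with _ | j
    · rw [hj] at hs; linarith
    · rw [hj] at hs hm
      exact mem_iUnion.2 ⟨j, hs, not_lt.1 (hm j (Nat.lt_succ_self j))⟩
  · intro j
    exact (hd j).trans (hp j).2.1
  · refine (ENNReal.tsum_le_tsum fun j => ?_).trans hsum.le
    exact (ENNReal.rpow_le_rpow (hd j) hα.le).trans (hp j).2.2

lemma cons_cover {Φ : Set (Set ℝ)} {α : ℝ} {U : Set ℝ} (hU : U ∈ Φ) {g : ℕ → Set ℝ}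
    (hg : ∀ j, g j ∈ Φ) {ε : ℝ≥0∞} (hUε : ediam U ≤ ε) (hgε : ∀ j, ediam (g j) ≤ ε) :
    ∃ g' : ℕ → Set ℝ, (∀ j, g' j ∈ Φ) ∧ (U ∪ ⋃ j, g j) ⊆ ⋃ j, g' j ∧
      (∀ j, ediam (g' j) ≤ ε) ∧ ∑' j, ediam (g' j) ^ α = ediam U ^ α + ∑' j, ediam (g j) ^ α := by
  refine ⟨fun j => Nat.casesOn j U g, ?_, ?_, ?_, ?_⟩
  · rintro (_ | j)
    · exact hU
    · exact hg j
  · rintro x (hx | hx)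
    · exact mem_iUnion.2 ⟨0, hx⟩
    · obtain ⟨j, hj⟩ := mem_iUnion.1 hx
      exact mem_iUnion.2 ⟨j + 1, hj⟩
  · rintro (_ | j)
    · exact hUε
    · exact hgε j
  · exact tsum_eq_zero_add' ENNReal.summable

lemma part1 (E : Set ℝ) {α : ℝ} (hα : 0 < α) : Hfam P.famP1 α E = Hfam P.famP α E := by
  refine le_antisymm ?_ (Hfam_anti (famP1_sub P) α E)
  rw [← one_mul (Hfam P.famP α E)]
  refine Hfam_le_mul one_ne_zero ENNReal.one_ne_top ?_ E
  rintro U ⟨c, k, n, h, hn, hU⟩ ε hε hUε δ hδ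
  have hUε' : ediam U ≤ ENNReal.ofReal (2 * ε) :=
    hUε.trans (ENNReal.ofReal_le_ofReal (by linarith))
  have hε' : 0 < ENNReal.ofReal (2 * ε) := by simpa using hε
  obtain ⟨M, hM, g, hg1, hg2, hg3, hg4⟩ := blocks P h n hα hε' hδ
  rw [one_mul]
  rcases hU with ⟨m, hnm, hU⟩ | hU
  · obtain ⟨g', h1, h2, h3, h4⟩ := cons_cover (α := α) (Φ := P.famP1)
      ⟨c, k, n, m, h, hn, hnm, hU⟩ hg1 hUε' hg3
    exact ⟨g', h1, subset_union_left.trans h2, h3, by rw [h4]; gcongr⟩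
  · rw [union_inf P h hn] at hU
    have hsub : Ioc (P.S c k + P.D c k * P.r c k / M)
        (P.S c k + P.D c k * P.r c k / ((n:ℝ) - 1)) ⊆ U := by
      rw [hU]
      apply Ioc_subset_Ioc_left
      have h1 := D_pos P h
      have : 0 ≤ P.D c k * P.r c k / M := by positivity
      linarith
    obtain ⟨g', h1, h2, h3, h4⟩ := cons_cover (α := α) (Φ := P.famP1)
      (mem_famP1 P h hn hM) hg1 ((ediam_mono hsub).trans hUε') hg3
    refine ⟨g', h1, Subset.trans ?_ h2, h3, ?_⟩
    · intro x hx
      rw [hU] at hx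
      rcases le_or_gt x (P.S c k + P.D c k * P.r c k / M) with hx' | hx'
      · exact .inr (hg2 ⟨hx.1, hx'⟩)
      · exact .inl ⟨hx', hx.2⟩
    · rw [h4]
      exact add_le_add (ENNReal.rpow_le_rpow (ediam_mono hsub) hα.le) hg4

lemma claimR {c : ℕ → ℕ} {k : ℕ} (h : P.AdmissibleUpTo c k) {y : ℝ} (hy : y ∈ P.cyl c k) :
    ∃ U ∈ P.famP, Ioc (P.S c k) y ⊆ U ∧ ediam U ≤ ENNReal.ofReal (2 * (y - P.S c k)) := by
  obtain ⟨p, hp, hp1, hp2⟩ := exists_digit P h hy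
  refine ⟨_, mem_famP P h hp, Ioc_subset_Ioc_right hp2, ?_⟩
  rw [Real.ediam_Ioc]
  apply ENNReal.ofReal_le_ofReal
  have h1 := D_pos P h
  have h2 := r_pos P c k
  have h3 : (P.r c k : ℝ) + 1 ≤ p := by exact_mod_cast hp
  have : P.D c k * P.r c k / ((p:ℝ) - 1) ≤ 2 * (P.D c k * P.r c k / p) := by
    rw [← mul_div_assoc, div_le_div_iff₀ (by linarith) (by linarith)]
    have : 0 < P.D c k * P.r c k := by positivity
    nlinarith
  linarith

lemma claimL {x ε : ℝ} (hε : 0 < ε) (N : ℕ) : ∀ (c : ℕ → ℕ) (k : ℕ), P.AdmissibleUpTo c k →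
    x ∈ P.cyl c k → P.S c k + P.D c k - x ≤ ε → P.D c k ≤ 2 ^ N * ε →
    ∃ U ∈ P.famP, Icc x (P.S c k + P.D c k) ⊆ U ∧ ediam U ≤ ENNReal.ofReal (2 * ε) := by
  induction N with
  | zero =>
    intro c k h hx _ hD
    refine ⟨_, cyl_mem_famP P h, fun z hz => ⟨hx.1.trans_le hz.1, hz.2⟩, ?_⟩
    rw [cyl, Real.ediam_Ioc]
    apply ENNReal.ofReal_le_ofReal
    simp at hD
    linarith
  | succ N ih =>
    intro c k h hx hxε hD
    obtain ⟨p, hp, hp1, hp2⟩ := exists_digit P h hx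
    have h1 := D_pos P h
    have h2 := r_pos P c k
    have e : P.S c k + P.D c k * P.r c k / (((P.r c k + 1 : ℕ) : ℝ) - 1) = P.S c k + P.D c k := by
      push_cast
      rw [add_sub_cancel_right, mul_div_cancel_right₀ _ (by linarith)]
    rcases hp.eq_or_lt with rfl | hlt
    · have e2 := SD_update P (c := c) (k := k) hp
      rw [e] at e2
      have := ih (Function.update c k (P.r c k + 1)) (k + 1) (adm_update P h hp)
        (by rw [cyl_update P hp]; exact ⟨hp1, hp2⟩) (by rw [e2]; exact hxε)
        (by have := D_half P h hp; rw [pow_succ] at hD; linarith)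
      rwa [e2] at this
    · have h3 : (P.r c k : ℝ) + 2 ≤ p := by exact_mod_cast hlt
      have hm := mem_famP1 P h (n := P.r c k + 1) (m := p) le_rfl hp
      rw [e] at hm
      refine ⟨_, famP1_sub P hm, fun z hz => ⟨hp1.trans_le hz.1, hz.2⟩, ?_⟩
      rw [Real.ediam_Ioc]
      apply ENNReal.ofReal_le_ofReal
      have key : P.D c k - P.D c k * P.r c k / p ≤
          2 * (P.D c k - P.D c k * P.r c k / ((p:ℝ) - 1)) := by
        have e1 : P.D c k - P.D c k * P.r c k / p = P.D c k * ((p - P.r c k) / p) := by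
          have : (p:ℝ) ≠ 0 := by linarith
          field_simp
        have e2 : 2 * (P.D c k - P.D c k * P.r c k / ((p:ℝ) - 1))
            = P.D c k * (2 * (p - 1 - P.r c k) / ((p:ℝ) - 1)) := by
          have : (p:ℝ) - 1 ≠ 0 := by linarith
          field_simp
        rw [e1, e2]
        refine mul_le_mul_of_nonneg_left ?_ h1.le
        rw [div_le_div_iff₀ (by linarith) (by linarith)]
        nlinarith
      linarith

lemma claimM {x y ε : ℝ} (hε : 0 < ε) (hxy : x ≤ y) (hyx : y - x ≤ ε) (N : ℕ) :
    ∀ (c : ℕ → ℕ) (k : ℕ), P.AdmissibleUpTo c k →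
    x ∈ P.cyl c k → y ∈ P.cyl c k → P.D c k ≤ 2 ^ N * ε →
    ∃ U₁ ∈ P.famP, ∃ U₂ ∈ P.famP, ∃ U₃ ∈ P.famP, Icc x y ⊆ U₁ ∪ (U₂ ∪ U₃) ∧
      ediam U₁ ≤ ENNReal.ofReal (2 * ε) ∧ ediam U₂ ≤ ENNReal.ofReal (2 * ε) ∧
      ediam U₃ ≤ ENNReal.ofReal (2 * ε) := by
  induction N with
  | zero =>
    intro c k h hx hy hD
    have hd : ediam (P.cyl c k) ≤ ENNReal.ofReal (2 * ε) := by
      rw [cyl, Real.ediam_Ioc]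
      apply ENNReal.ofReal_le_ofReal
      simp at hD
      linarith
    have hm := cyl_mem_famP P h
    refine ⟨_, hm, _, hm, _, hm, fun z hz => .inl ⟨hx.1.trans_le hz.1, hz.2.trans hy.2⟩, hd, hd, hd⟩
  | succ N ih =>
    intro c k h hx hy hD
    obtain ⟨p, hp, hp1, hp2⟩ := exists_digit P h hx
    obtain ⟨q, hq, hq1, hq2⟩ := exists_digit P h hy
    have h1 := D_pos P h
    have h2 := r_pos P c k
    have hp' : (P.r c k : ℝ) + 1 ≤ p := by exact_mod_cast hp
    have hq' : (P.r c k : ℝ) + 1 ≤ q := by exact_mod_cast hq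
    have hxp : x ∈ P.cyl (Function.update c k p) (k + 1) := by
      rw [cyl_update P hp]; exact ⟨hp1, hp2⟩
    have hyq : y ∈ P.cyl (Function.update c k q) (k + 1) := by
      rw [cyl_update P hq]; exact ⟨hq1, hq2⟩
    rcases lt_trichotomy p q with hpq | rfl | hpq
    · have hpq' : (p:ℝ) + 1 ≤ q := by exact_mod_cast hpq
      have := end_mono P h (a := p) (b := (q:ℝ) - 1) (by linarith) (by linarith)
      linarith
    · exact ih _ _ (adm_update P h hp) hxp hyq
        (by have := D_half P h hp; rw [pow_succ] at hD; linarith)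
    · have hpq' : (q:ℝ) + 1 ≤ p := by exact_mod_cast hpq
      have hee := end_mono P h (a := q) (b := (p:ℝ) - 1) (by linarith) (by linarith)
      obtain ⟨N', hN'⟩ := pow_unbounded_of_one_lt
        (P.D (Function.update c k p) (k + 1) / ε) (one_lt_two (α := ℝ))
      rw [div_lt_iff₀ hε] at hN'
      obtain ⟨U₁, hU₁, hs₁, hd₁⟩ := claimL P hε N' (Function.update c k p) (k + 1)
        (adm_update P h hp) hxp (by rw [SD_update P hp]; linarith) hN'.le
      obtain ⟨U₃, hU₃, hs₃, hd₃⟩ := claimR P (adm_update P h hq) hyq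
      rw [SD_update P hp] at hs₁
      rw [S_update] at hs₃ hd₃
      replace hd₃ : ediam U₃ ≤ ENNReal.ofReal (2 * ε) :=
        hd₃.trans (ENNReal.ofReal_le_ofReal (by linarith))
      rcases Nat.lt_or_ge (q + 1) p with hlt | hge
      · have hm := mem_famP1 P h (n := q + 1) (m := p - 1) (by omega) (by omega)
        have e : ((p - 1 : ℕ) : ℝ) = (p:ℝ) - 1 := by
          rw [Nat.cast_sub (by omega)]; simp
        rw [e] at hm
        push_cast at hm
        rw [add_sub_cancel_right] at hm
        refine ⟨U₁, hU₁, _, famP1_sub P hm, U₃, hU₃, ?_, hd₁, ?_, hd₃⟩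
        · intro z hz
          rcases le_or_gt z (P.S c k + P.D c k * P.r c k / ((p:ℝ) - 1)) with hz1 | hz1
          · exact .inl (hs₁ ⟨hz.1, hz1⟩)
          rcases le_or_gt z (P.S c k + P.D c k * P.r c k / q) with hz2 | hz2
          · exact .inr (.inl ⟨hz1, hz2⟩)
          · exact .inr (.inr (hs₃ ⟨hz2, hz.2⟩))
        · rw [Real.ediam_Ioc]
          exact ENNReal.ofReal_le_ofReal (by linarith)
      · have e : (p:ℝ) - 1 = q := by
          have : p = q + 1 := by omega
          rw [this]; push_cast; ring
        refine ⟨U₁, hU₁, U₁, hU₁, U₃, hU₃, ?_, hd₁, hd₁, hd₃⟩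
        intro z hz
        rcases le_or_gt z (P.S c k + P.D c k * P.r c k / ((p:ℝ) - 1)) with hz1 | hz1
        · exact .inl (hs₁ ⟨hz.1, hz1⟩)
        · rw [e] at hz1
          exact .inr (.inr (hs₃ ⟨hz1, hz.2⟩))

lemma adm_zero (c : ℕ → ℕ) : P.AdmissibleUpTo c 0 := fun i hi => absurd hi (Nat.not_lt_zero i)

lemma cover_set {V : Set ℝ} (hV : V ⊆ Ioc 0 1) {ε : ℝ} (hε : 0 < ε)
    (hVε : ediam V ≤ ENNReal.ofReal ε) :
    ∃ U₁ ∈ P.famP, ∃ U₂ ∈ P.famP, ∃ U₃ ∈ P.famP, V ⊆ U₁ ∪ (U₂ ∪ U₃) ∧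
      ediam U₁ ≤ ENNReal.ofReal (2 * ε) ∧ ediam U₂ ≤ ENNReal.ofReal (2 * ε) ∧
      ediam U₃ ≤ ENNReal.ofReal (2 * ε) := by
  have hS : P.S (fun _ => 0) 0 = 0 := by simp [PerronSystem.S]
  have hD : P.D (fun _ => 0) 0 = 1 := by simp [PerronSystem.D, rprod, qprod]
  have hcyl : P.cyl (fun _ => 0) 0 = Ioc 0 1 := by rw [cyl, hS, hD, zero_add]
  have ha := adm_zero P (fun _ => 0)
  have main : ∀ x y : ℝ, 0 < x → x ≤ y → y ≤ 1 → y - x ≤ ε → V ⊆ Icc x y →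
    ∃ U₁ ∈ P.famP, ∃ U₂ ∈ P.famP, ∃ U₃ ∈ P.famP, V ⊆ U₁ ∪ (U₂ ∪ U₃) ∧
      ediam U₁ ≤ ENNReal.ofReal (2 * ε) ∧ ediam U₂ ≤ ENNReal.ofReal (2 * ε) ∧
      ediam U₃ ≤ ENNReal.ofReal (2 * ε) := by
    intro x y hx hxy hy hyx hVxy
    obtain ⟨N, hN⟩ := pow_unbounded_of_one_lt (1 / ε) (one_lt_two (α := ℝ))
    rw [div_lt_iff₀ hε] at hN
    obtain ⟨U₁, h₁, U₂, h₂, U₃, h₃, hs, hd⟩ := claimM P hε hxy hyx N (fun _ => 0) 0 ha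
      (by rw [hcyl]; exact ⟨hx, by linarith⟩) (by rw [hcyl]; exact ⟨by linarith, hy⟩)
      (by rw [hD]; exact hN.le)
    exact ⟨U₁, h₁, U₂, h₂, U₃, h₃, hVxy.trans hs, hd⟩
  rcases V.eq_empty_or_nonempty with rfl | hne
  · exact main 1 1 one_pos le_rfl le_rfl (by simpa using hε.le) (empty_subset _)
  have hb : Bornology.IsBounded V := (isBounded_Ioc 0 1).subset hV
  rw [Real.ediam_eq hb, ENNReal.ofReal_le_ofReal_iff hε.le] at hVε
  have hba : BddAbove V := hb.bddAbove
  have hbb : BddBelow V := hb.bddBelow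
  have hsub : V ⊆ Icc (sInf V) (sSup V) := fun z hz => ⟨csInf_le hbb hz, le_csSup hba hz⟩
  have h0 : 0 ≤ sInf V := le_csInf hne fun z hz => (hV hz).1.le
  have h1 : sSup V ≤ 1 := csSup_le hne fun z hz => (hV hz).2
  obtain ⟨v, hv⟩ := hne
  rcases h0.eq_or_lt with h0 | h0
  · have hpos : 0 < sSup V := (hV hv).1.trans_le (hsub hv).2
    obtain ⟨U, hU, hs, hd⟩ := claimR P ha (y := sSup V) (by rw [hcyl]; exact ⟨hpos, h1⟩)
    rw [hS] at hs hd
    have hd' : ediam U ≤ ENNReal.ofReal (2 * ε) :=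
      hd.trans (ENNReal.ofReal_le_ofReal (by linarith))
    exact ⟨U, hU, U, hU, U, hU, fun z hz => .inl (hs ⟨(hV hz).1, (hsub hz).2⟩), hd', hd', hd'⟩
  · exact main _ _ h0 ((hsub hv).1.trans (hsub hv).2) h1 hVε hsub

lemma part2 {E : Set ℝ} (hE : E ⊆ Ioc 0 1) {α : ℝ} (hα : 0 < α) :
    Hfam P.famP α E ≤ 3 * 2 ^ α * Measure.hausdorffMeasure α E := by
  have hC0 : (3 * 2 ^ α : ℝ≥0∞) ≠ 0 := by
    simp [hα.le]
  have hC : (3 * 2 ^ α : ℝ≥0∞) ≠ ⊤ :=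
    ENNReal.mul_ne_top (by norm_num) (ENNReal.rpow_ne_top_of_nonneg hα.le (by norm_num))
  refine (Hfam_le_mul hC0 hC ?_ E).trans (mul_le_mul_right (Hfam_le_hausdorff hα hE) _)
  intro V hV ε hε hVε δ hδ
  have hδ2 : 0 < δ / 2 := ENNReal.half_pos hδ.ne'
  obtain ⟨η, hη0, hηε, hVη, hη⟩ : ∃ η : ℝ, 0 < η ∧ η ≤ ε ∧ ediam V ≤ ENNReal.ofReal η ∧
      3 * ENNReal.ofReal (2 * η) ^ α ≤ 3 * 2 ^ α * ediam V ^ α + δ / 2 := by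
    rcases eq_or_ne (ediam V) 0 with h0 | h0
    · have T1 : Tendsto (fun η : ℝ => 3 * ENNReal.ofReal (2 * η) ^ α) (nhdsWithin 0 (Ioi 0))
          (nhds 0) := by
        have hc : Continuous (fun η : ℝ => 3 * ENNReal.ofReal (2 * η) ^ α) := by
          refine (ENNReal.continuous_const_mul (by norm_num)).comp
            (ENNReal.continuous_rpow_const.comp (ENNReal.continuous_ofReal.comp (by fun_prop)))
        have := hc.tendsto 0
        simp only [mul_zero, ENNReal.ofReal_zero, ENNReal.zero_rpow_of_pos hα] at this
        exact this.mono_left nhdsWithin_le_nhds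
      obtain ⟨η, h1, h2⟩ := ((T1.eventually_le_const hδ2).and (Ioc_mem_nhdsGT hε)).exists
      exact ⟨η, h2.1, h2.2, by simp [h0], h1.trans le_add_self⟩
    · have htop : ediam V ≠ ⊤ := ne_top_of_le_ne_top ENNReal.ofReal_ne_top hVε
      have e : ENNReal.ofReal (ediam V).toReal = ediam V := ENNReal.ofReal_toReal htop
      refine ⟨(ediam V).toReal, ENNReal.toReal_pos h0 htop, ENNReal.toReal_le_of_le_ofReal hε.le hVε,
        e.ge, ?_⟩
      rw [ENNReal.ofReal_mul (by norm_num), e, ENNReal.mul_rpow_of_nonneg _ _ hα.le]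
      simp [mul_assoc]
  obtain ⟨U₁, h₁, U₂, h₂, U₃, h₃, hs, hd₁, hd₂, hd₃⟩ := cover_set P hV hη0 hVη
  have hη' : 0 < ENNReal.ofReal (2 * η) := by simpa using hη0
  obtain ⟨_, _, g, hg1, _, hg3, hg4⟩ := blocks P (adm_zero P fun _ => 0) 0 hα hη' hδ2
  obtain ⟨g1, a1, b1, c1, d1⟩ := cons_cover (α := α) h₃ (fun j => famP1_sub P (hg1 j)) hd₃ hg3
  obtain ⟨g2, a2, b2, c2, d2⟩ := cons_cover (α := α) h₂ a1 hd₂ c1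
  obtain ⟨g3, a3, b3, c3, d3⟩ := cons_cover (α := α) h₁ a2 hd₁ c2
  refine ⟨g3, a3, ?_, fun j => (c3 j).trans (ENNReal.ofReal_le_ofReal (by linarith)), ?_⟩
  · refine (hs.trans ?_).trans b3
    refine union_subset_union_right _ (Subset.trans ?_ b2)
    exact union_subset_union_right _ (subset_union_left.trans b1)
  · rw [d3, d2, d1]
    have q := fun {U : Set ℝ} (h : ediam U ≤ ENNReal.ofReal (2 * η)) =>
      ENNReal.rpow_le_rpow h hα.le
    calc _ ≤ ENNReal.ofReal (2 * η) ^ α + (ENNReal.ofReal (2 * η) ^ α +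
          (ENNReal.ofReal (2 * η) ^ α + δ / 2)) :=
          add_le_add (q hd₁) (add_le_add (q hd₂) (add_le_add (q hd₃) hg4))
      _ = 3 * ENNReal.ofReal (2 * η) ^ α + δ / 2 := by ring
      _ ≤ 3 * 2 ^ α * ediam V ^ α + δ / 2 + δ / 2 := by gcongr
      _ = _ := by rw [add_assoc, ENNReal.add_halves]

lemma dim_eq {E : Set ℝ} (hE : E ⊆ Ioc 0 1) : dimFam P.famP1 E = dimH E := by
  apply le_antisymm
  · refine le_of_forall_gt fun a ha => ?_
    obtain ⟨d, hd1, hd2⟩ := ENNReal.lt_iff_exists_nnreal_btwn.1 ha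
    have h0 := hausdorffMeasure_of_dimH_lt hd1
    have hd0 : (0:ℝ) < d := by
      have : (0:ℝ≥0∞) < d := lt_of_le_of_lt zero_le hd1
      exact_mod_cast this
    have hz : Hfam P.famP1 d E = 0 := by
      have := part2 P hE hd0
      rw [h0, mul_zero] at this
      rw [part1 P E hd0]
      exact le_antisymm this zero_le
    refine lt_of_le_of_lt ?_ hd2
    unfold dimFam
    refine iInf_le_of_le (d:ℝ) (iInf_le_of_le hd0 (iInf_le_of_le hz ?_))
    simp
  · unfold dimFam
    refine le_iInf fun α => le_iInf fun hα => le_iInf fun hz => ?_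
    have h0 : Measure.hausdorffMeasure α E = 0 :=
      le_antisymm ((hausdorff_le_Hfam P.famP1 α E).trans hz.le) zero_le
    have := dimH_le_of_hausdorffMeasure_ne_top (s := E) (d := α.toNNReal)
      (by rw [Real.coe_toNNReal _ hα.le, h0]; exact ENNReal.zero_ne_top)
    exact this

end PerronAux

/-- `H^α(E,𝔓₁) = H^α(E,𝔓)` for every `E ⊆ (0,1]` and `α > 0`, and the family
`𝔓₁` of finite unions of consecutive cylinders is faithful for the Hausdorff dimension
calculation on `(0,1]`. -/
theorem famP1_faithful (P : PerronSystem) :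
    (∀ E : Set ℝ, E ⊆ Set.Ioc 0 1 → ∀ α : ℝ, 0 < α →
      Hfam P.famP1 α E = Hfam P.famP α E) ∧
    (∀ E : Set ℝ, E ⊆ Set.Ioc 0 1 → dimFam P.famP1 E = dimH E) := by
  exact ⟨fun E _ α hα => PerronAux.part1 P E hα, fun E hE => PerronAux.dim_eq P hE⟩
end
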